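/- Let λ > 1 be a constant, let 𝒢 ~ 𝒢(n, λ/n), and let U ⊆ V. There exist constants c = c(λ) > 0 and C > 0 such that for every A > 0 and every n, with probability at least 1 − C·e^{−cA²}, every connected component 𝓛 of 𝒢 of maximum size satisfies | |𝓛 ∩ U| − θ(λ)·|U| | < A√n. -/

import Mathlib

open scoped Classical
open Finset

/-- Spin configurations on `n` vertices with `q` spins. -/
abbrev Conf (n q : ℕ) := Fin n → Fin q

/-- Number of vertices assigned spin `j`. -/
def cntN {n q : ℕ} (X : Conf n q) (j : Fin q) : ℕ :=
  (Finset.univ.filter (fun v => X v = j)).card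

/-- Number of monochromatic pairs `{u,v}` (`u < v`, same spin). -/
def numMono {n q : ℕ} (σ : Conf n q) : ℕ :=
  (Finset.univ.filter (fun p : Fin n × Fin n => p.1 < p.2 ∧ σ p.1 = σ p.2)).card

/-- The mean-field `q`-state Potts measure: probability of `σ`. -/
noncomputable def pottsProb (n q : ℕ) (β : ℝ) (σ : Conf n q) : ℝ :=
  Real.exp (β / n * numMono σ) / ∑ τ : Conf n q, Real.exp (β / n * numMono τ)

/-- The set of monochromatic pairs of a configuration. -/
def monoPairs {n q : ℕ} (σ : Conf n q) : Finset (Fin n × Fin n) :=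
  Finset.univ.filter (fun p : Fin n × Fin n => p.1 < p.2 ∧ σ p.1 = σ p.2)

/-- The graph on `Fin n` whose edges are the pairs in `E`. -/
def graphOf {n : ℕ} (E : Finset (Fin n × Fin n)) : SimpleGraph (Fin n) :=
  SimpleGraph.fromRel (fun u v => (u, v) ∈ E)

/-- Number of connected components of the graph `(V, E)`. -/
noncomputable def numComps {n : ℕ} (E : Finset (Fin n × Fin n)) : ℕ :=
  Nat.card (graphOf E).ConnectedComponent

/-- One-step transition probability of the Swendsen–Wang dynamics:
percolate on monochromatic pairs with probability `p = 1 - exp (-β/n)`,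
then color each connected component uniformly at random. -/
noncomputable def swStep (n q : ℕ) (β : ℝ) (σ τ : Conf n q) : ℝ :=
  ∑ E ∈ (monoPairs σ).powerset,
    ((1 - Real.exp (-(β / n))) ^ E.card *
        Real.exp (-(β / n)) ^ ((monoPairs σ).card - E.card)) *
      (if ∀ u v : Fin n, (graphOf E).Reachable u v → τ u = τ v then
        ((q : ℝ))⁻¹ ^ numComps E else 0)

/-- `t`-step transition probability of the Swendsen–Wang dynamics. -/
noncomputable def swProb (n q : ℕ) (β : ℝ) : ℕ → Conf n q → Conf n q → ℝ
  | 0, σ, τ => if σ = τ then 1 else 0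
  | t + 1, σ, τ => ∑ η : Conf n q, swStep n q β σ η * swProb n q β t η τ

/-- Probability of observing the trajectory `ω 0, ω 1, …, ω (ℓ-1)` at times
`1, …, ℓ` for the SW dynamics started at `X₀`. -/
noncomputable def pathProb (n q : ℕ) (β : ℝ) (X₀ : Conf n q) (ℓ : ℕ)
    (ω : Fin ℓ → Conf n q) : ℝ :=
  ∏ i : Fin ℓ, swStep n q β
    (if _h : 0 < (i : ℕ) then
        ω ⟨(i : ℕ) - 1, lt_of_le_of_lt (Nat.sub_le _ _) i.isLt⟩
      else X₀) (ω i)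

/-- Total variation distance between two probability vectors on configurations. -/
noncomputable def tvDist {n q : ℕ} (f g : Conf n q → ℝ) : ℝ :=
  (∑ τ : Conf n q, |f τ - g τ|) / 2

/-- Mixing time `τ_mix(ε)` of the SW dynamics. -/
noncomputable def mixingTime (n q : ℕ) (β ε : ℝ) : ℕ :=
  sInf {t : ℕ | ∀ σ : Conf n q, tvDist (swProb n q β t σ) (pottsProb n q β) ≤ ε}

/-- `theta lam` is the unique root in `(0,1)` of `exp (-lam * x) = 1 - x`
for `lam > 1`, and `0` for `lam ≤ 1`. -/
noncomputable def theta (lam : ℝ) : ℝ :=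
  if lam ≤ 1 then 0
  else sSup {x : ℝ | x ∈ Set.Ioo (0 : ℝ) 1 ∧ Real.exp (-lam * x) = 1 - x}

/-- The drift function `F`. -/
noncomputable def F (q : ℕ) (β : ℝ) (x : ℝ) : ℝ :=
  1 / q + (1 - 1 / q) * theta (β * x) * x

/-- The unique fixed point of `F` in `(1/q, 1]` (for `β > q`). -/
noncomputable def aFix (q : ℕ) (β : ℝ) : ℝ :=
  sSup {x : ℝ | x ∈ Set.Ioc (1 / (q : ℝ)) 1 ∧ F q β x = x}

/-- The cutoff constant `c(β,q) = (2 log (1 / F'(a)))⁻¹`. -/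
noncomputable def cConst (q : ℕ) (β : ℝ) : ℝ :=
  (2 * Real.log (1 / deriv (F q β) (aFix q β)))⁻¹

/-- Fraction of vertices assigned spin `j`. -/
noncomputable def cntFrac {n q : ℕ} (X : Conf n q) : Fin q → ℝ :=
  fun j => (cntN X j : ℝ) / n

/-- The proportions vector `α(X)`: fractions of vertices of each spin,
sorted in nonincreasing order. -/
noncomputable def alphaVec {n q : ℕ} (X : Conf n q) : Fin q → ℝ :=
  fun i => cntFrac X (Tuple.sort (cntFrac X) i.rev)

/-- `ℓ∞` distance between two vectors indexed by `Fin q`. -/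
noncomputable def linf {q : ℕ} (f g : Fin q → ℝ) : ℝ :=
  ⨆ i : Fin q, |f i - g i|

/-- The vector `κ(b) = (b, (1-b)/(q-1), …, (1-b)/(q-1))`. -/
noncomputable def kappaVec (q : ℕ) (b : ℝ) : Fin q → ℝ :=
  fun i => if (i : ℕ) = 0 then b else (1 - b) / ((q : ℝ) - 1)

/-- The majority vector `m = (a, (1-a)/(q-1), …, (1-a)/(q-1))`. -/
noncomputable def mVec (q : ℕ) (β : ℝ) : Fin q → ℝ :=
  kappaVec q (aFix q β)

/-- Index of the most common spin of `X` (least such index on ties). -/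
noncomputable def domIdx {n q : ℕ} (X : Conf n q) : ℕ :=
  sInf {j : ℕ | ∃ hj : j < q, ∀ j' : Fin q, cntN X j' ≤ cntN X ⟨j, hj⟩}

/-- `α₁(X)`: fraction of vertices carrying the most common spin of `X`. -/
noncomputable def alpha1 {n q : ℕ} (X : Conf n q) : ℝ :=
  ((Finset.univ.filter (fun v : Fin n => (X v : ℕ) = domIdx X)).card : ℝ) / n

/-- `α_{1,k}(X)`: fraction of vertices of `Vk` carrying the most common spin of `X`. -/
noncomputable def alpha1In {n q : ℕ} (X : Conf n q) (Vk : Finset (Fin n)) : ℝ :=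
  ((Vk.filter (fun v => (X v : ℕ) = domIdx X)).card : ℝ) / Vk.card

/-- `P` is a partition of the vertex set into `q` classes. -/
def IsPartition {n q : ℕ} (P : Fin q → Finset (Fin n)) : Prop :=
  (∀ i j, i ≠ j → Disjoint (P i) (P j)) ∧ ∀ v : Fin n, ∃ i, v ∈ P i

/-- A `λ`-partition: a partition with all classes of size at least `λ n`. -/
def IsLamPartition {n q : ℕ} (lam : ℝ) (P : Fin q → Finset (Fin n)) : Prop :=
  IsPartition P ∧ ∀ i, lam * n ≤ ((P i).card : ℝ)

/-- Projection: `projCnt P X i j` is the number of vertices of `P i`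
assigned spin `j` in `X`. -/
def projCnt {n q : ℕ} (P : Fin q → Finset (Fin n)) (X : Conf n q) :
    Fin q → Fin q → ℕ :=
  fun i j => ((P i).filter (fun v => X v = j)).card

/-- All potential edges of the complete graph on `Fin n`. -/
def allPairs (n : ℕ) : Finset (Fin n × Fin n) :=
  Finset.univ.filter (fun p : Fin n × Fin n => p.1 < p.2)

/-- Probability of the edge set `E` under the Erdős–Rényi measure `G(n,p)`. -/
noncomputable def erProb (n : ℕ) (p : ℝ) (E : Finset (Fin n × Fin n)) : ℝ :=
  p ^ E.card * (1 - p) ^ ((allPairs n).card - E.card)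

/-- Size of the connected component of `v` in the graph `(V, E)`. -/
noncomputable def compCard {n : ℕ} (E : Finset (Fin n × Fin n)) (v : Fin n) : ℕ :=
  (Finset.univ.filter (fun u => (graphOf E).Reachable v u)).card

/-- `L₁`: size of the largest connected component. -/
noncomputable def L1 {n : ℕ} (E : Finset (Fin n × Fin n)) : ℕ :=
  Finset.univ.sup (fun v => compCard E v)

/-- Sum of the squares of the component sizes, `Σ_j L_j²`
(computed as `Σ_v |C(v)|`). -/
noncomputable def sumCompSq {n : ℕ} (E : Finset (Fin n × Fin n)) : ℕ :=
  ∑ v : Fin n, compCard E v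

/-- Expectation of `f` under the Erdős–Rényi measure `G(n,p)`. -/
noncomputable def erExp (n : ℕ) (p : ℝ) (f : Finset (Fin n × Fin n) → ℝ) : ℝ :=
  ∑ E ∈ (allPairs n).powerset, erProb n p E * f E

/-- Random-cluster weight of an edge set with parameters `q`, `p = 1 - exp (-β/n)`. -/
noncomputable def rcWeight (n q : ℕ) (β : ℝ) (E : Finset (Fin n × Fin n)) : ℝ :=
  (1 - Real.exp (-(β / n))) ^ E.card *
    Real.exp (-(β / n)) ^ ((allPairs n).card - E.card) * (q : ℝ) ^ numComps E

/-- The mean-field random-cluster measure: probability of the edge set `E`. -/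
noncomputable def rcProb (n q : ℕ) (β : ℝ) (E : Finset (Fin n × Fin n)) : ℝ :=
  rcWeight n q β E / ∑ B ∈ (allPairs n).powerset, rcWeight n q β B

/-- Expectation of `f E` when `E ⊆ S` contains each element of `S` independently with
probability `p`. -/
noncomputable def bernExp {α : Type*} (p : ℝ) (S : Finset α) (f : Finset α → ℝ) : ℝ :=
  ∑ E ∈ S.powerset, p ^ E.card * (1 - p) ^ (S.card - E.card) * f E

theorem bernExp_const {α : Type*} (p : ℝ) (S : Finset α) (a : ℝ) :
    bernExp p S (fun _ => a) = a := by
  unfold bernExp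
  rw [← Finset.sum_mul, Finset.sum_pow_mul_eq_add_pow]
  simp

theorem bernExp_mul_left {α : Type*} (p : ℝ) (S : Finset α) (a : ℝ) (f : Finset α → ℝ) :
    bernExp p S (fun E => a * f E) = a * bernExp p S f := by
  unfold bernExp
  rw [Finset.mul_sum]
  exact Finset.sum_congr rfl fun E _ => by ring

theorem bernExp_add {α : Type*} (p : ℝ) (S : Finset α) (f g : Finset α → ℝ) :
    bernExp p S (fun E => f E + g E) = bernExp p S f + bernExp p S g := by
  unfold bernExp
  rw [← Finset.sum_add_distrib]
  exact Finset.sum_congr rfl fun E _ => by ring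

theorem bernExp_mono {α : Type*} {p : ℝ} (hp : 0 ≤ p) (hp1 : p ≤ 1) {S : Finset α}
    {f g : Finset α → ℝ} (h : ∀ E, E ⊆ S → f E ≤ g E) : bernExp p S f ≤ bernExp p S g := by
  unfold bernExp
  refine Finset.sum_le_sum fun E hE => ?_
  have : 0 ≤ 1 - p := by linarith
  exact mul_le_mul_of_nonneg_left (h E (Finset.mem_powerset.1 hE)) (by positivity)

theorem bernExp_congr {α : Type*} (p : ℝ) {S : Finset α} {f g : Finset α → ℝ}
    (h : ∀ E, E ⊆ S → f E = g E) : bernExp p S f = bernExp p S g := by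
  unfold bernExp
  exact Finset.sum_congr rfl fun E hE => by rw [h E (Finset.mem_powerset.1 hE)]

theorem bernExp_empty {α : Type*} (p : ℝ) (f : Finset α → ℝ) : bernExp p ∅ f = f ∅ := by
  simp [bernExp]

theorem bernExp_insert {α : Type*} [DecidableEq α] (p : ℝ) {S : Finset α} {a : α} (ha : a ∉ S)
    (f : Finset α → ℝ) :
    bernExp p (insert a S) f =
      p * bernExp p S (fun E => f (insert a E)) + (1 - p) * bernExp p S f := by
  unfold bernExp
  rw [Finset.sum_powerset_insert ha, Finset.mul_sum, Finset.mul_sum, add_comm]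
  congr 1
  · refine Finset.sum_congr rfl fun E hE => ?_
    have hE' := Finset.mem_powerset.1 hE
    rw [Finset.card_insert_of_notMem ha, Finset.card_insert_of_notMem (fun h => ha (hE' h)),
      Nat.add_sub_add_right]
    ring
  · refine Finset.sum_congr rfl fun E hE => ?_
    have hE' := Finset.card_le_card (Finset.mem_powerset.1 hE)
    rw [Finset.card_insert_of_notMem ha, Nat.sub_add_comm hE']
    ring

theorem bernExp_union {α : Type*} [DecidableEq α] (p : ℝ) {S T : Finset α} (h : Disjoint S T)
    (f : Finset α → ℝ) :
    bernExp p (S ∪ T) f = bernExp p T (fun E₂ => bernExp p S (fun E₁ => f (E₁ ∪ E₂))) := by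
  induction T using Finset.induction_on generalizing f with
  | empty => simp [bernExp_empty]
  | insert a T ha ih =>
    have haS : a ∉ S := fun haS => Finset.disjoint_left.1 h haS (Finset.mem_insert_self a T)
    have hd : Disjoint S T := h.mono_right (Finset.subset_insert a T)
    rw [Finset.union_insert, bernExp_insert p (by simp [ha, haS]), bernExp_insert p ha, ih hd, ih hd]
    simp only [Finset.union_insert]

theorem bernExp_image_prod {α β : Type*} [DecidableEq α] [DecidableEq β] (p : ℝ) (R : Finset β)
    (e : β → α) (he : Set.InjOn e R) (x y : β → ℝ) :
    bernExp p (R.image e) (fun E => ∏ w ∈ R, if e w ∈ E then x w else y w) =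
      ∏ w ∈ R, (p * x w + (1 - p) * y w) := by
  induction R using Finset.induction_on with
  | empty => simp [bernExp_empty]
  | insert a R ha ih =>
    have he' : Set.InjOn e R := he.mono (by simp)
    have hne : ∀ w ∈ R, e w ≠ e a := fun w hw h =>
      ha (he (by simp [hw]) (by simp) h ▸ hw)
    have hea : e a ∉ R.image e := by
      simp only [Finset.mem_image, not_exists, not_and]
      exact hne
    rw [Finset.image_insert, bernExp_insert p hea, Finset.prod_insert ha, ← ih he', add_mul]
    congr 1
    · rw [mul_assoc, ← bernExp_mul_left p _ (x a)]
      congr 1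
      refine bernExp_congr p fun E hE => ?_
      rw [Finset.prod_insert ha, if_pos (Finset.mem_insert_self _ _)]
      congr 1
      refine Finset.prod_congr rfl fun w hw => ?_
      simp [hne w hw]
    · rw [mul_assoc, ← bernExp_mul_left p _ (y a)]
      congr 1
      refine bernExp_congr p fun E hE => ?_
      rw [Finset.prod_insert ha, if_neg (fun h => hea (hE h))]

theorem bernoulli_mgf_le {p c : ℝ} (hp : 0 ≤ p) (hp1 : p ≤ 1) (hc : |c| ≤ 1) :
    p * Real.exp (c * (0 - (1 - p))) + (1 - p) * Real.exp (c * (1 - (1 - p))) ≤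
      Real.exp (c ^ 2 * p) := by
  have key : ∀ x : ℝ, |x| ≤ 1 → Real.exp x ≤ 1 + x + x ^ 2 := fun x hx => by
    have := (abs_le.1 (Real.abs_exp_sub_one_sub_id_le hx)).2
    linarith
  have h1 := key (c * (0 - (1 - p))) (by
    rw [abs_mul]
    exact mul_le_one₀ hc (abs_nonneg _) (by rw [abs_le]; constructor <;> linarith))
  have h2 := key (c * (1 - (1 - p))) (by
    rw [abs_mul]
    exact mul_le_one₀ hc (abs_nonneg _) (by rw [abs_le]; constructor <;> linarith))
  have h3 := Real.add_one_le_exp (c ^ 2 * p)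
  have h4 := mul_le_mul_of_nonneg_left h1 hp
  have h5 := mul_le_mul_of_nonneg_left h2 (sub_nonneg.2 hp1)
  have h6 : 0 ≤ c ^ 2 * p ^ 2 := by positivity
  nlinarith

theorem bernExp_image_exp_le {α β : Type*} [DecidableEq α] [DecidableEq β] {p c : ℝ}
    (hp : 0 ≤ p) (hp1 : p ≤ 1) (hc : |c| ≤ 1) {R B : Finset β} (hB : B ⊆ R)
    (e : β → α) (he : Set.InjOn e R) :
    bernExp p (R.image e)
        (fun E => Real.exp (c * (((B.filter (fun w => e w ∉ E)).card : ℝ) - (1 - p) * B.card))) ≤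
      Real.exp (c ^ 2 * p * B.card) := by
  have h1 : bernExp p (R.image e)
        (fun E => Real.exp (c * (((B.filter (fun w => e w ∉ E)).card : ℝ) - (1 - p) * B.card))) =
      bernExp p (R.image e) (fun E => ∏ w ∈ R, if e w ∈ E
        then (if w ∈ B then Real.exp (c * (0 - (1 - p))) else 1)
        else (if w ∈ B then Real.exp (c * (1 - (1 - p))) else 1)) := by
    refine bernExp_congr p fun E _ => ?_
    have : ∀ w, (if e w ∈ E
        then (if w ∈ B then Real.exp (c * (0 - (1 - p))) else 1)
        else (if w ∈ B then Real.exp (c * (1 - (1 - p))) else 1)) =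
        if w ∈ B then Real.exp (c * ((if e w ∉ E then 1 else 0) - (1 - p))) else 1 := by
      intro w
      split_ifs <;> rfl
    simp only [this]
    rw [← Finset.prod_filter, Finset.filter_mem_eq_inter, Finset.inter_eq_right.2 hB,
      ← Real.exp_sum, ← Finset.mul_sum, Finset.sum_sub_distrib, Finset.sum_boole]
    rw [Finset.sum_const, nsmul_eq_mul, mul_comm (1 - p)]
  rw [h1, bernExp_image_prod p R e he]
  have h2 : ∀ w ∈ R, p * (if w ∈ B then Real.exp (c * (0 - (1 - p))) else 1) +
      (1 - p) * (if w ∈ B then Real.exp (c * (1 - (1 - p))) else 1) ≤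
      if w ∈ B then Real.exp (c ^ 2 * p) else 1 := by
    intro w _
    split_ifs
    · exact bernoulli_mgf_le hp hp1 hc
    · linarith
  have hq : 0 ≤ 1 - p := by linarith
  refine (Finset.prod_le_prod (fun w _ => ?_) h2).trans_eq ?_
  · split_ifs <;> positivity
  · rw [← Finset.prod_filter, Finset.filter_mem_eq_inter, Finset.inter_eq_right.2 hB,
      Finset.prod_const, ← Real.exp_nat_mul]
    ring_nf

/-- The ordered pair of `allPairs n` representing the edge between `v` and `w`. -/
def edgePair {n : ℕ} (v w : Fin n) : Fin n × Fin n := (min v w, max v w)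

theorem edgePair_injective {n : ℕ} (v : Fin n) : Function.Injective (edgePair v) := by
  intro w w' h
  simp only [edgePair, Prod.mk.injEq] at h
  grind

/-- The potential edges with both endpoints in `R`. -/
def pairsIn {n : ℕ} (R : Finset (Fin n)) : Finset (Fin n × Fin n) :=
  (allPairs n).filter (fun e => e.1 ∈ R ∧ e.2 ∈ R)

theorem edgePair_mem_pairsIn {n : ℕ} {R : Finset (Fin n)} {v w : Fin n} (hvw : v ≠ w) :
    edgePair v w ∈ pairsIn R ↔ v ∈ R ∧ w ∈ R := by
  rcases lt_or_gt_of_ne hvw with h | h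
  · simp [edgePair, pairsIn, allPairs, h.le, h]
  · simp [edgePair, pairsIn, allPairs, h.le, h, and_comm]

theorem pairsIn_univ (n : ℕ) : pairsIn (Finset.univ : Finset (Fin n)) = allPairs n := by
  simp [pairsIn]

theorem pairsIn_empty (n : ℕ) : pairsIn (∅ : Finset (Fin n)) = ∅ := by
  simp [pairsIn]

theorem pairsIn_eq_union {n : ℕ} {R : Finset (Fin n)} {v : Fin n} (hv : v ∈ R) :
    pairsIn R = pairsIn (R.erase v) ∪ (R.erase v).image (edgePair v) := by
  ext ⟨a, b⟩
  simp only [pairsIn, allPairs, Finset.mem_filter, Finset.mem_univ, true_and, Finset.mem_union,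
    Finset.mem_image, Finset.mem_erase, edgePair, Prod.mk.injEq]
  constructor
  · rintro ⟨hab, ha, hb⟩
    by_cases hav : a = v
    · subst hav
      exact Or.inr ⟨b, ⟨hab.ne', hb⟩, min_eq_left hab.le, max_eq_right hab.le⟩
    · by_cases hbv : b = v
      · subst hbv
        exact Or.inr ⟨a, ⟨hab.ne, ha⟩, min_eq_right hab.le, max_eq_left hab.le⟩
      · exact Or.inl ⟨hab, ⟨hav, ha⟩, hbv, hb⟩
  · rintro (⟨hab, ⟨_, ha⟩, _, hb⟩ | ⟨w, ⟨hwv, hw⟩, rfl, rfl⟩)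
    · exact ⟨hab, ha, hb⟩
    · rcases lt_or_gt_of_ne hwv with h | h
      · simp [h.le, h, hw, hv]
      · simp [h.le, h, hw, hv]

theorem disjoint_pairsIn_star {n : ℕ} (R : Finset (Fin n)) (v : Fin n) :
    Disjoint (pairsIn (R.erase v)) ((R.erase v).image (edgePair v)) := by
  rw [Finset.disjoint_right]
  intro e he h
  obtain ⟨w, hw, rfl⟩ := Finset.mem_image.1 he
  have := (edgePair_mem_pairsIn (Finset.ne_of_mem_erase hw).symm).1 h
  simp at this

/-- The next vertex processed by the exploration of a graph. A state `(R, N)` consists of the set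
`R` of unprocessed vertices and the set `N ⊆ R` of undiscovered vertices. A discovered
unprocessed vertex is chosen if there is one. -/
noncomputable def pick {n : ℕ} [NeZero n] (x : Finset (Fin n) × Finset (Fin n)) : Fin n :=
  if h : (x.1 \ x.2).Nonempty then h.choose else if h : x.1.Nonempty then h.choose else 0

theorem pick_mem {n : ℕ} [NeZero n] {x : Finset (Fin n) × Finset (Fin n)} (h : x.1.Nonempty) :
    pick x ∈ x.1 := by
  unfold pick
  split_ifs with h1
  · exact (Finset.mem_sdiff.1 h1.choose_spec).1
  · exact h.choose_spec

theorem pick_notMem {n : ℕ} [NeZero n] {x : Finset (Fin n) × Finset (Fin n)} (hx : x.2 ⊆ x.1)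
    (h : x.1 ≠ x.2) : pick x ∉ x.2 := by
  have h1 : (x.1 \ x.2).Nonempty := by
    rw [Finset.sdiff_nonempty]
    exact fun h' => h (h'.antisymm hx)
  unfold pick
  rw [dif_pos h1]
  exact (Finset.mem_sdiff.1 h1.choose_spec).2

/-- One step of the exploration: process the vertex `pick x` and discover its neighbours. -/
noncomputable def exploreStep {n : ℕ} [NeZero n] (E : Finset (Fin n × Fin n))
    (x : Finset (Fin n) × Finset (Fin n)) : Finset (Fin n) × Finset (Fin n) :=
  (x.1.erase (pick x), (x.2.erase (pick x)).filter (fun w => edgePair (pick x) w ∉ E))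

theorem exploreStep_subset {n : ℕ} [NeZero n] (E : Finset (Fin n × Fin n))
    {x : Finset (Fin n) × Finset (Fin n)} (hx : x.2 ⊆ x.1) :
    (exploreStep E x).2 ⊆ (exploreStep E x).1 :=
  (Finset.filter_subset _ _).trans (Finset.erase_subset_erase _ hx)

theorem exploreStep_congr {n : ℕ} [NeZero n] {E E' : Finset (Fin n × Fin n)}
    {x : Finset (Fin n) × Finset (Fin n)}
    (h : ∀ w ∈ x.2.erase (pick x), edgePair (pick x) w ∈ E ↔ edgePair (pick x) w ∈ E') :
    exploreStep E x = exploreStep E' x := by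
  unfold exploreStep
  congr 1
  exact Finset.filter_congr fun w hw => not_congr (h w hw)

theorem exploreStep_iterate_congr {n : ℕ} [NeZero n] {E E' : Finset (Fin n × Fin n)} (i : ℕ) :
    ∀ x : Finset (Fin n) × Finset (Fin n), x.2 ⊆ x.1 → (∀ e ∈ pairsIn x.1, e ∈ E ↔ e ∈ E') →
      (exploreStep E)^[i] x = (exploreStep E')^[i] x := by
  induction i with
  | zero => intros; rfl
  | succ i ih =>
    intro x hx h
    have h1 : exploreStep E x = exploreStep E' x := by
      refine exploreStep_congr fun w hw => h _ ?_
      have hw' := hx (Finset.mem_of_mem_erase hw)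
      exact (edgePair_mem_pairsIn (Finset.ne_of_mem_erase hw).symm).2 ⟨pick_mem ⟨w, hw'⟩, hw'⟩
    rw [Function.iterate_succ_apply, Function.iterate_succ_apply, ← h1]
    refine ih _ (exploreStep_subset E hx) fun e he => h e ?_
    simp only [exploreStep, pairsIn, Finset.mem_filter, Finset.mem_erase] at he ⊢
    tauto

/-- The martingale increment counting the undiscovered vertices of `W` along an exploration step
from `x` to `x'`. -/
noncomputable def exploreInc {n : ℕ} [NeZero n] (p : ℝ) (W : Finset (Fin n))
    (x x' : Finset (Fin n) × Finset (Fin n)) : ℝ :=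
  (1 - p) ^ x'.1.card * (((x'.2 ∩ W).card : ℝ) - (1 - p) * ((x.2.erase (pick x)) ∩ W).card)

theorem bernExp_exp_exploreInc_le {n : ℕ} [NeZero n] {p : ℝ} (hp : 0 ≤ p) (hp1 : p ≤ 1)
    (W : Finset (Fin n)) {s : ℝ} (hs : |s| ≤ 1) {x : Finset (Fin n) × Finset (Fin n)}
    (hx : x.2 ⊆ x.1) :
    bernExp p ((x.1.erase (pick x)).image (edgePair (pick x)))
      (fun E => Real.exp (s * exploreInc p W x (exploreStep E x))) ≤ Real.exp (s ^ 2 * (p * n)) := by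
  have hq0 : 0 ≤ 1 - p := by linarith
  have hc1 : (1 - p) ^ (x.1.erase (pick x)).card ≤ 1 := pow_le_one₀ hq0 (by linarith)
  have hc0 : 0 ≤ (1 - p) ^ (x.1.erase (pick x)).card := by positivity
  set c := s * (1 - p) ^ (x.1.erase (pick x)).card with hc
  have hcs : c ^ 2 ≤ s ^ 2 := by
    rw [hc, mul_pow]
    exact mul_le_of_le_one_right (sq_nonneg s) (pow_le_one₀ hc0 hc1)
  have hcabs : |c| ≤ 1 := by
    rw [hc, abs_mul, abs_of_nonneg hc0]
    exact mul_le_one₀ hs hc0 hc1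
  set B := (x.2.erase (pick x)) ∩ W with hB
  have hBR : B ⊆ x.1.erase (pick x) :=
    Finset.inter_subset_left.trans (Finset.erase_subset_erase _ hx)
  have key := bernExp_image_exp_le hp hp1 hcabs hBR (edgePair (pick x))
    (edgePair_injective _).injOn
  have heq : ∀ E : Finset (Fin n × Fin n), s * exploreInc p W x (exploreStep E x) =
      c * (((B.filter (fun w => edgePair (pick x) w ∉ E)).card : ℝ) - (1 - p) * B.card) := by
    intro E
    simp only [exploreInc, exploreStep, hc, hB, Finset.filter_inter]
    ring
  simp only [heq]
  refine key.trans (Real.exp_le_exp.2 ?_)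
  have hBn : (B.card : ℝ) ≤ n := by
    exact_mod_cast (Finset.card_le_univ B).trans_eq (Fintype.card_fin n)
  rw [mul_assoc]
  exact mul_le_mul hcs (mul_le_mul_of_nonneg_left hBn hp) (by positivity) (by positivity)

/-- Doob-type maximal inequality for the exploration started from an arbitrary state. -/
theorem bernExp_exploreInc_maximal {n : ℕ} [NeZero n] {p : ℝ} (hp : 0 ≤ p) (hp1 : p ≤ 1)
    (W : Finset (Fin n)) {s : ℝ} (hs : |s| ≤ 1) (b : ℝ) (k : ℕ) :
    ∀ (x : Finset (Fin n) × Finset (Fin n)) (m : ℝ), x.2 ⊆ x.1 → x.1.card = k →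
      bernExp p (pairsIn x.1) (fun E => if ∃ j, b ≤ m + s * ∑ i ∈ Finset.range j,
        exploreInc p W ((exploreStep E)^[i] x) ((exploreStep E)^[i + 1] x) then 1 else 0) ≤
      Real.exp (m - b) * Real.exp (s ^ 2 * (p * n)) ^ k := by
  induction k with
  | zero =>
    intro x m hx hk
    have h1 : x.1 = ∅ := Finset.card_eq_zero.1 hk
    have h2 : x.2 = ∅ := Finset.subset_empty.1 (h1 ▸ hx)
    have h3 : x = (∅, ∅) := Prod.ext h1 h2
    subst h3
    rw [pairsIn_empty, bernExp_empty]
    have hfix : exploreStep (∅ : Finset (Fin n × Fin n)) (∅, ∅) = (∅, ∅) := by simp [exploreStep]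
    simp only [Function.iterate_fixed hfix]
    have hinc : exploreInc p W (∅, ∅) (∅, ∅) = 0 := by simp [exploreInc]
    simp only [hinc, Finset.sum_const_zero, mul_zero, add_zero, exists_const, pow_zero, mul_one]
    split_ifs with h
    · exact Real.one_le_exp (by linarith)
    · positivity
  | succ k ih =>
    intro x m hx hk
    have hκ : 1 ≤ Real.exp (s ^ 2 * (p * n)) := Real.one_le_exp (by positivity)
    by_cases hbm : b ≤ m
    · calc _ ≤ bernExp p (pairsIn x.1) (fun _ => 1) :=
            bernExp_mono hp hp1 fun E _ => by split_ifs <;> norm_num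
        _ = 1 := bernExp_const _ _ _
        _ ≤ _ := one_le_mul_of_one_le_of_one_le (Real.one_le_exp (by linarith))
            (one_le_pow₀ hκ)
    have hne : x.1.Nonempty := Finset.card_pos.1 (by omega)
    have hv := pick_mem hne
    rw [pairsIn_eq_union hv, bernExp_union p (disjoint_pairsIn_star _ _)]
    calc _ ≤ bernExp p ((x.1.erase (pick x)).image (edgePair (pick x))) (fun E₂ =>
            (Real.exp (m - b) * Real.exp (s ^ 2 * (p * n)) ^ k) *
              Real.exp (s * exploreInc p W x (exploreStep E₂ x))) := by
          refine bernExp_mono hp hp1 fun E₂ hE₂ => ?_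
          have hsub := exploreStep_subset E₂ hx
          have hcard : (exploreStep E₂ x).1.card = k := by
            simp [exploreStep, Finset.card_erase_of_mem hv, hk]
          refine (bernExp_mono hp hp1 fun E₁ hE₁ => ?_).trans
            ((ih (exploreStep E₂ x) (m + s * exploreInc p W x (exploreStep E₂ x))
              hsub hcard).trans_eq ?_)
          · have hstep : exploreStep (E₁ ∪ E₂) x = exploreStep E₂ x := by
              refine exploreStep_congr fun w hw => ?_
              rw [Finset.mem_union, or_iff_right]
              intro h
              have := (edgePair_mem_pairsIn (Finset.ne_of_mem_erase hw).symm).1 (hE₁ h)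
              simp at this
            have hiter : ∀ i, (exploreStep (E₁ ∪ E₂))^[i] (exploreStep E₂ x) =
                (exploreStep E₁)^[i] (exploreStep E₂ x) := by
              intro i
              refine exploreStep_iterate_congr i _ hsub fun e he => ?_
              rw [Finset.mem_union, or_iff_left]
              exact fun h => Finset.disjoint_left.1 (disjoint_pairsIn_star _ _) he (hE₂ h)
            have himp : (∃ j, b ≤ m + s * ∑ i ∈ Finset.range j,
                exploreInc p W ((exploreStep (E₁ ∪ E₂))^[i] x)
                  ((exploreStep (E₁ ∪ E₂))^[i + 1] x)) →
                ∃ j, b ≤ m + s * exploreInc p W x (exploreStep E₂ x) +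
                  s * ∑ i ∈ Finset.range j, exploreInc p W ((exploreStep E₁)^[i] (exploreStep E₂ x))
                  ((exploreStep E₁)^[i + 1] (exploreStep E₂ x)) := by
              rintro ⟨j, hj⟩
              cases j with
              | zero => simp at hj; exact absurd hj hbm
              | succ j =>
                refine ⟨j, hj.trans_eq ?_⟩
                rw [Finset.sum_range_succ']
                simp only [Function.iterate_succ_apply, hstep, hiter, Function.iterate_zero, id]
                simp only [← Function.iterate_succ_apply, hiter]
                ring
            by_cases hex : ∃ j, b ≤ m + s * ∑ i ∈ Finset.range j,
                exploreInc p W ((exploreStep (E₁ ∪ E₂))^[i] x)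
                  ((exploreStep (E₁ ∪ E₂))^[i + 1] x)
            · rw [if_pos hex, if_pos (himp hex)]
            · rw [if_neg hex]
              split_ifs <;> norm_num
          · rw [show m + s * exploreInc p W x (exploreStep E₂ x) - b =
              (m - b) + s * exploreInc p W x (exploreStep E₂ x) by ring, Real.exp_add]
            ring
      _ ≤ _ := by
          rw [bernExp_mul_left, pow_succ _ k, ← mul_assoc (Real.exp (m - b))]
          exact mul_le_mul_of_nonneg_left (bernExp_exp_exploreInc_le hp hp1 W hs hx)
            (by positivity)

/-- The state of the exploration of the edge set `E` after `j` steps. -/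
noncomputable def explored {n : ℕ} [NeZero n] (E : Finset (Fin n × Fin n)) (j : ℕ) :
    Finset (Fin n) × Finset (Fin n) :=
  (exploreStep E)^[j] (Finset.univ, Finset.univ)

theorem explored_succ {n : ℕ} [NeZero n] (E : Finset (Fin n × Fin n)) (j : ℕ) :
    explored E (j + 1) = exploreStep E (explored E j) :=
  Function.iterate_succ_apply' _ _ _

theorem explored_subset {n : ℕ} [NeZero n] (E : Finset (Fin n × Fin n)) (j : ℕ) :
    (explored E j).2 ⊆ (explored E j).1 := by
  induction j with
  | zero => exact Finset.Subset.refl _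
  | succ j ih =>
    rw [explored_succ]
    exact exploreStep_subset E ih

theorem card_explored {n : ℕ} [NeZero n] (E : Finset (Fin n × Fin n)) (j : ℕ) :
    (explored E j).1.card = n - j := by
  induction j with
  | zero => simp [explored]
  | succ j ih =>
    rw [explored_succ]
    by_cases h : (explored E j).1.Nonempty
    · simp only [exploreStep]
      rw [Finset.card_erase_of_mem (pick_mem h), ih]
      omega
    · rw [Finset.not_nonempty_iff_eq_empty] at h
      simp only [exploreStep, h, Finset.erase_empty, Finset.card_empty] at ih ⊢
      omega

theorem explored_antitone {n : ℕ} [NeZero n] (E : Finset (Fin n × Fin n)) :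
    Antitone fun j => (explored E j).1 := by
  refine antitone_nat_of_succ_le fun j => ?_
  simp only [explored_succ]
  exact Finset.erase_subset _ _

/-- At time `j` every discovered vertex has been processed. -/
def IsSeedTime {n : ℕ} [NeZero n] (E : Finset (Fin n × Fin n)) (j : ℕ) : Prop :=
  (explored E j).1 = (explored E j).2

theorem isSeedTime_zero {n : ℕ} [NeZero n] (E : Finset (Fin n × Fin n)) : IsSeedTime E 0 := rfl

theorem explored_fst_eq_empty {n : ℕ} [NeZero n] (E : Finset (Fin n × Fin n)) :
    (explored E n).1 = ∅ := by
  rw [← Finset.card_eq_zero, card_explored, Nat.sub_self]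

theorem isSeedTime_self {n : ℕ} [NeZero n] (E : Finset (Fin n × Fin n)) : IsSeedTime E n := by
  have h := explored_subset E n
  rw [explored_fst_eq_empty, Finset.subset_empty] at h
  rw [IsSeedTime, h, explored_fst_eq_empty]

/-- `s < t` are consecutive elements of the set of naturals satisfying `Z`. -/
def Consecutive (Z : ℕ → Prop) (s t : ℕ) : Prop :=
  s < t ∧ Z s ∧ Z t ∧ ∀ i, s < i → i < t → ¬ Z i

theorem Consecutive.right_unique {Z : ℕ → Prop} {s t t' : ℕ} (h : Consecutive Z s t)
    (h' : Consecutive Z s t') : t = t' := by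
  rcases lt_trichotomy t t' with hlt | heq | hlt
  · exact absurd h.2.2.1 (h'.2.2.2 t h.1 hlt)
  · exact heq
  · exact absurd h'.2.2.1 (h.2.2.2 t' h'.1 hlt)

theorem exists_consecutive {Z : ℕ → Prop} {s n : ℕ} (hs : Z s) (hn : Z n) (hsn : s < n) :
    ∃ t, t ≤ n ∧ Consecutive Z s t := by
  classical
  have hex : ∃ t, s < t ∧ Z t := ⟨n, hsn, hn⟩
  refine ⟨Nat.find hex, Nat.find_min' hex ⟨hsn, hn⟩, (Nat.find_spec hex).1, hs,
    (Nat.find_spec hex).2, fun i hi hit hZ => Nat.find_min hex hit ⟨hi, hZ⟩⟩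

theorem graphOf_adj_of_mem {n : ℕ} {E : Finset (Fin n × Fin n)} {v w : Fin n} (hvw : v ≠ w)
    (h : edgePair v w ∈ E) : (graphOf E).Adj v w := by
  rw [graphOf, SimpleGraph.fromRel_adj]
  refine ⟨hvw, ?_⟩
  rcases le_total v w with hle | hle
  · left; simpa [edgePair, hle] using h
  · right; simpa [edgePair, hle] using h

theorem edgePair_mem_of_adj {n : ℕ} {E : Finset (Fin n × Fin n)} (hE : E ⊆ allPairs n)
    {v w : Fin n} (h : (graphOf E).Adj v w) : edgePair v w ∈ E := by
  rw [graphOf, SimpleGraph.fromRel_adj] at h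
  obtain ⟨-, h | h⟩ := h
  · have := hE h
    simp only [allPairs, Finset.mem_filter, Finset.mem_univ, true_and] at this
    simpa [edgePair, this.le] using h
  · have := hE h
    simp only [allPairs, Finset.mem_filter, Finset.mem_univ, true_and] at this
    simpa [edgePair, this.le] using h

theorem not_adj_explored {n : ℕ} [NeZero n] {E : Finset (Fin n × Fin n)} (hE : E ⊆ allPairs n)
    (j : ℕ) {u w : Fin n} (hu : u ∉ (explored E j).1) (hw : w ∈ (explored E j).2) :
    ¬ (graphOf E).Adj u w := by
  induction j with
  | zero => simp [explored] at hu
  | succ j ih =>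
    simp only [explored_succ, exploreStep, Finset.mem_erase, Finset.mem_filter, not_and] at hu hw
    by_cases huv : u = pick (explored E j)
    · subst huv
      exact fun h => hw.2 (edgePair_mem_of_adj hE h)
    · exact ih (hu huv) hw.1.2

theorem mem_explored_of_reachable {n : ℕ} [NeZero n] {E : Finset (Fin n × Fin n)}
    (hE : E ⊆ allPairs n) {j : ℕ} (hj : IsSeedTime E j) {u w : Fin n}
    (h : (graphOf E).Reachable u w) (hu : u ∈ (explored E j).1) : w ∈ (explored E j).1 := by
  obtain ⟨p⟩ := h
  induction p with
  | nil => exact hu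
  | cons hadj p ih =>
    refine ih ?_
    by_contra hv
    exact not_adj_explored hE j hv (hj ▸ hu) hadj.symm

theorem reachable_pick {n : ℕ} [NeZero n] {E : Finset (Fin n × Fin n)} {s : ℕ}
    (hs : IsSeedTime E s) (d : ℕ) (hd : ∀ i, s < i → i < s + 1 + d → ¬ IsSeedTime E i)
    {u : Fin n} (hu : u ∈ (explored E s).1) (hu' : u ∉ (explored E (s + 1 + d)).2) :
    (graphOf E).Reachable (pick (explored E s)) u := by
  induction d generalizing u with
  | zero =>
    by_cases huv : u = pick (explored E s)
    · rw [huv]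
    · have huN : u ∈ (explored E s).2 := hs ▸ hu
      simp only [add_zero, explored_succ, exploreStep, Finset.mem_filter, Finset.mem_erase,
        not_and, not_not] at hu'
      exact (graphOf_adj_of_mem (Ne.symm huv) (hu' ⟨huv, huN⟩)).reachable
  | succ d ih =>
    have ih' := fun {u : Fin n} => @ih (fun i hi hi' => hd i hi (by omega)) u
    by_cases huN : u ∈ (explored E (s + 1 + d)).2
    · set v := pick (explored E (s + 1 + d)) with hv
      have hseed := hd (s + 1 + d) (by omega) (by omega)
      have hvN : v ∉ (explored E (s + 1 + d)).2 := pick_notMem (explored_subset E _) hseed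
      have hvR : v ∈ (explored E s).1 :=
        explored_antitone E (by omega : s ≤ s + 1 + d)
          (pick_mem ⟨u, explored_subset E _ huN⟩)
      have huv : u ≠ v := fun h => hvN (h ▸ huN)
      rw [← add_assoc, explored_succ] at hu'
      simp only [exploreStep, ← hv, Finset.mem_filter, Finset.mem_erase, not_and, not_not] at hu'
      exact (ih' hvR hvN).trans (graphOf_adj_of_mem huv.symm (hu' ⟨huv, huN⟩)).reachable
    · exact ih' hu huN

theorem filter_reachable_eq {n : ℕ} [NeZero n] {E : Finset (Fin n × Fin n)}
    (hE : E ⊆ allPairs n) {s t : ℕ} (hst : Consecutive (IsSeedTime E) s t) {v : Fin n}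
    (hv : v ∈ (explored E s).1) (hv' : v ∉ (explored E t).1) :
    Finset.univ.filter (fun u => (graphOf E).Reachable v u) =
      (explored E s).1 \ (explored E t).1 := by
  obtain ⟨hlt, hs, ht, hno⟩ := hst
  have hreach : ∀ u, u ∈ (explored E s).1 → u ∉ (explored E t).1 →
      (graphOf E).Reachable (pick (explored E s)) u := by
    intro u hu hu'
    obtain ⟨d, rfl⟩ := Nat.exists_eq_add_of_le (Nat.succ_le_of_lt hlt)
    exact reachable_pick hs d hno hu (fun h => hu' (ht ▸ h))
  ext u
  simp only [Finset.mem_filter, Finset.mem_univ, true_and, Finset.mem_sdiff]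
  constructor
  · intro h
    exact ⟨mem_explored_of_reachable hE hs h hv,
      fun hu => hv' (mem_explored_of_reachable hE ht h.symm hu)⟩
  · rintro ⟨hu, hu'⟩
    exact (hreach v hv hv').symm.trans (hreach u hu hu')

theorem exists_consecutive_mem {n : ℕ} [NeZero n] (E : Finset (Fin n × Fin n)) (v : Fin n) :
    ∃ s t, t ≤ n ∧ Consecutive (IsSeedTime E) s t ∧ v ∈ (explored E s).1 ∧
      v ∉ (explored E t).1 := by
  classical
  set P : ℕ → Prop := fun i => IsSeedTime E i ∧ v ∈ (explored E i).1 with hP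
  have h0 : P 0 := ⟨isSeedTime_zero E, by simp [explored]⟩
  obtain ⟨hs, hvs⟩ : P (Nat.findGreatest P n) := Nat.findGreatest_spec (Nat.zero_le n) h0
  set s := Nat.findGreatest P n with hsdef
  have hsn : s < n := by
    refine lt_of_le_of_ne (Nat.findGreatest_le n) fun h => ?_
    rw [h, explored_fst_eq_empty] at hvs
    simp at hvs
  obtain ⟨t, htn, hst⟩ := exists_consecutive hs (isSeedTime_self E) hsn
  exact ⟨s, t, htn, hst, hvs, fun hvt =>
    Nat.findGreatest_is_greatest (P := P) hst.1 htn ⟨hst.2.2.1, hvt⟩⟩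

theorem card_explored_sdiff {n : ℕ} [NeZero n] (E : Finset (Fin n × Fin n)) {s t : ℕ}
    (hst : s ≤ t) (htn : t ≤ n) : ((explored E s).1 \ (explored E t).1).card = t - s := by
  rw [Finset.card_sdiff_of_subset (explored_antitone E hst), card_explored, card_explored]
  omega

theorem sub_le_L1 {n : ℕ} [NeZero n] {E : Finset (Fin n × Fin n)} (hE : E ⊆ allPairs n) {s t : ℕ}
    (hst : Consecutive (IsSeedTime E) s t) (htn : t ≤ n) : t - s ≤ L1 E := by
  have hcard := card_explored_sdiff E hst.1.le htn
  have hne : ((explored E s).1 \ (explored E t).1).Nonempty := by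
    rw [← Finset.card_pos, hcard]
    have := hst.1
    omega
  obtain ⟨v, hv⟩ := hne
  rw [Finset.mem_sdiff] at hv
  rw [← hcard, ← filter_reachable_eq hE hst hv.1 hv.2]
  exact Finset.le_sup (f := fun v => compCard E v) (Finset.mem_univ v)

theorem exploreInc_explored {n : ℕ} [NeZero n] (p : ℝ) (W : Finset (Fin n))
    (E : Finset (Fin n × Fin n)) {i : ℕ} (hi : i < n) :
    exploreInc p W (explored E i) (explored E (i + 1)) =
      (1 - p) ^ (n - (i + 1)) * ((explored E (i + 1)).2 ∩ W).card -
        (1 - p) ^ (n - i) * ((explored E i).2 ∩ W).card +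
        (1 - p) ^ (n - i) * (if pick (explored E i) ∈ (explored E i).2 ∩ W then 1 else 0) := by
  have hpow : (1 - p) ^ (n - i) = (1 - p) ^ (n - (i + 1)) * (1 - p) := by
    rw [← pow_succ]
    congr 1
    omega
  have hcard : (((explored E i).2.erase (pick (explored E i)) ∩ W).card : ℝ) =
      ((explored E i).2 ∩ W).card -
        (if pick (explored E i) ∈ (explored E i).2 ∩ W then 1 else 0) := by
    rw [Finset.erase_inter]
    split_ifs with h
    · rw [Finset.card_erase_of_mem h, Nat.cast_pred (Finset.card_pos.2 ⟨_, h⟩)]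
    · rw [Finset.erase_eq_of_notMem h, sub_zero]
  rw [exploreInc, card_explored, hpow, hcard]
  ring

theorem sum_exploreInc {n : ℕ} [NeZero n] (p : ℝ) (W : Finset (Fin n))
    (E : Finset (Fin n × Fin n)) {t : ℕ} (ht : t ≤ n) :
    ∑ i ∈ Finset.range t, exploreInc p W (explored E i) (explored E (i + 1)) =
      (1 - p) ^ (n - t) * ((explored E t).2 ∩ W).card - (1 - p) ^ n * W.card +
        ∑ i ∈ Finset.range t, (1 - p) ^ (n - i) *
          (if pick (explored E i) ∈ (explored E i).2 ∩ W then (1 : ℝ) else 0) := by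
  induction t with
  | zero => simp [explored]
  | succ t ih =>
    rw [Finset.sum_range_succ, Finset.sum_range_succ, ih (by omega),
      exploreInc_explored p W E (by omega)]
    ring

theorem isSeedTime_of_pick_mem {n : ℕ} [NeZero n] {E : Finset (Fin n × Fin n)} {i : ℕ}
    (h : pick (explored E i) ∈ (explored E i).2) : IsSeedTime E i := by
  by_contra hs
  exact pick_notMem (explored_subset E i) hs h

theorem mul_pow_le_pow_sub_mul {b q : ℝ} (hb : 0 ≤ b) (hq0 : 0 ≤ q) (hq1 : q ≤ 1) (n t : ℕ) :
    b * q ^ n ≤ q ^ (n - t) * b := by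
  rw [mul_comm]
  exact mul_le_mul_of_nonneg_right (pow_le_pow_of_le_one hq0 hq1 (n.sub_le t)) hb

/-- The martingale of the exploration with respect to `W` stays below `b * (1 - p) ^ n` in
absolute value. -/
def Concentrated {n : ℕ} [NeZero n] (p b : ℝ) (W : Finset (Fin n))
    (E : Finset (Fin n × Fin n)) : Prop :=
  ∀ t, |∑ i ∈ Finset.range t, exploreInc p W (explored E i) (explored E (i + 1))| <
    b * (1 - p) ^ n

theorem Concentrated.card_le {n : ℕ} [NeZero n] {p b : ℝ} (hp1 : p < 1)
    {W : Finset (Fin n)} {E : Finset (Fin n × Fin n)} (h : Concentrated p b W E) (hb : 0 ≤ b)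
    (hp : 0 ≤ p) {t : ℕ} (ht : t ≤ n) :
    (((explored E t).2 ∩ W).card : ℝ) ≤ (1 - p) ^ t * W.card + b := by
  have hq : 0 < 1 - p := by linarith
  have h1 := (abs_lt.1 (h t)).2
  rw [sum_exploreInc p W E ht] at h1
  have h2 : 0 ≤ ∑ i ∈ Finset.range t, (1 - p) ^ (n - i) *
      (if pick (explored E i) ∈ (explored E i).2 ∩ W then (1 : ℝ) else 0) :=
    Finset.sum_nonneg fun i _ => mul_nonneg (by positivity) (by split_ifs <;> norm_num)
  have h3 : (1 - p) ^ n = (1 - p) ^ (n - t) * (1 - p) ^ t := (pow_sub_mul_pow _ ht).symm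
  have h4 := mul_pow_le_pow_sub_mul hb hq.le (by linarith : 1 - p ≤ 1) n t
  refine le_of_mul_le_mul_left ?_ (pow_pos hq (n - t))
  rw [mul_add, ← mul_assoc, ← h3]
  linarith

theorem Concentrated.le_card {n : ℕ} [NeZero n] {p b : ℝ} (hp1 : p < 1)
    {W : Finset (Fin n)} {E : Finset (Fin n × Fin n)} (h : Concentrated p b W E) (hb : 0 ≤ b)
    (hp : 0 ≤ p) {t : ℕ} (ht : t ≤ n) :
    (1 - p) ^ t * W.card - b - ((Finset.range t).filter (IsSeedTime E)).card ≤
      (((explored E t).2 ∩ W).card : ℝ) := by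
  have hq : 0 < 1 - p := by linarith
  have h1 := (abs_lt.1 (h t)).1
  rw [sum_exploreInc p W E ht] at h1
  have h2 : ∑ i ∈ Finset.range t, (1 - p) ^ (n - i) *
      (if pick (explored E i) ∈ (explored E i).2 ∩ W then (1 : ℝ) else 0) ≤
      (1 - p) ^ (n - t) * ((Finset.range t).filter (IsSeedTime E)).card := by
    rw [← Finset.sum_boole, Finset.mul_sum]
    refine Finset.sum_le_sum fun i hi => ?_
    have hit := Finset.mem_range.1 hi
    by_cases hm : pick (explored E i) ∈ (explored E i).2 ∩ W
    · rw [if_pos hm, if_pos (isSeedTime_of_pick_mem (Finset.mem_inter.1 hm).1), mul_one, mul_one]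
      exact pow_le_pow_of_le_one hq.le (by linarith) (by omega)
    · rw [if_neg hm, mul_zero]
      exact mul_nonneg (by positivity) (by split_ifs <;> norm_num)
  have h3 : (1 - p) ^ n = (1 - p) ^ (n - t) * (1 - p) ^ t := (pow_sub_mul_pow _ ht).symm
  have h4 := mul_pow_le_pow_sub_mul hb hq.le (by linarith : 1 - p ≤ 1) n t
  refine le_of_mul_le_mul_left ?_ (pow_pos hq (n - t))
  rw [mul_sub, mul_sub, ← mul_assoc, ← h3]
  linarith

theorem Concentrated.le_of_consecutive {n : ℕ} [NeZero n] {p b : ℝ} (hp1 : p < 1)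
    {E : Finset (Fin n × Fin n)} (h : Concentrated p b Finset.univ E) (hb : 0 ≤ b)
    (hp : 0 ≤ p) {s t : ℕ} (hst : Consecutive (IsSeedTime E) s t) (ht : t ≤ n) :
    (1 - p) ^ (t - s) * ((n : ℝ) - s - 1) - 2 * b ≤ (n : ℝ) - t := by
  have hq : 0 < 1 - p := by linarith
  obtain ⟨hlt, hs, hts, hno⟩ := hst
  have h1 := (abs_lt.1 (h s)).2
  have h2 := (abs_lt.1 (h t)).1
  rw [sum_exploreInc p _ E ht] at h2
  rw [sum_exploreInc p _ E (hlt.le.trans ht)] at h1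
  simp only [Finset.inter_univ] at h1 h2
  have hcs : ((explored E s).2.card : ℝ) = n - s := by
    rw [← hs, card_explored, Nat.cast_sub (hlt.le.trans ht)]
  have hct : ((explored E t).2.card : ℝ) = n - t := by
    rw [← hts, card_explored, Nat.cast_sub ht]
  rw [hcs] at h1
  rw [hct] at h2
  have h5 : ∑ i ∈ Finset.range t, (1 - p) ^ (n - i) *
      (if pick (explored E i) ∈ (explored E i).2 then (1 : ℝ) else 0) ≤
      ∑ i ∈ Finset.range s, (1 - p) ^ (n - i) *
      (if pick (explored E i) ∈ (explored E i).2 then (1 : ℝ) else 0) + (1 - p) ^ (n - s) := by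
    rw [← Finset.sum_range_add_sum_Ico _ (Nat.succ_le_of_lt hlt), Finset.sum_range_succ]
    have h6 : ∑ i ∈ Finset.Ico (s + 1) t, (1 - p) ^ (n - i) *
      (if pick (explored E i) ∈ (explored E i).2 then (1 : ℝ) else 0) = 0 := by
      refine Finset.sum_eq_zero fun i hi => ?_
      rw [Finset.mem_Ico] at hi
      rw [if_neg, mul_zero]
      exact fun hm => hno i (by omega) hi.2 (isSeedTime_of_pick_mem hm)
    have h7 : (1 - p) ^ (n - s) *
        (if pick (explored E s) ∈ (explored E s).2 then (1 : ℝ) else 0) ≤ (1 - p) ^ (n - s) :=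
      mul_le_of_le_one_right (by positivity) (by split_ifs <;> norm_num)
    simp only [Nat.succ_eq_add_one, h6]
    linarith
  have h8 : (1 - p) ^ (n - s) = (1 - p) ^ (n - t) * (1 - p) ^ (t - s) := by
    rw [← pow_add]; congr 1; omega
  have h4 := mul_pow_le_pow_sub_mul hb hq.le (by linarith : 1 - p ≤ 1) n t
  refine le_of_mul_le_mul_left ?_ (pow_pos hq (n - t))
  rw [mul_sub, ← mul_assoc, ← h8]
  linarith

theorem theta_spec {lam : ℝ} (hlam : 1 < lam) :
    0 < theta lam ∧ theta lam < 1 ∧ Real.exp (-lam * theta lam) = 1 - theta lam := by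
  set S : Set ℝ := {x : ℝ | x ∈ Set.Ioo (0 : ℝ) 1 ∧ Real.exp (-lam * x) = 1 - x} with hS
  have htheta : theta lam = sSup S := by
    rw [theta, if_neg (not_le.2 hlam)]
  have hex : ∃ x, x ∈ S := by
    set x₀ := (lam - 1) / (2 * lam) with hx₀
    have hx₀pos : 0 < x₀ := div_pos (by linarith) (by linarith)
    have hx₀lt : x₀ < 1 := by
      rw [hx₀, div_lt_one (by linarith)]
      linarith
    have hlx : lam * x₀ = (lam - 1) / 2 := by
      rw [hx₀]
      field_simp
    have h1 : Real.exp (-lam * x₀) < 1 - x₀ := by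
      have h2 : lam * x₀ + 1 ≤ Real.exp (lam * x₀) := Real.add_one_le_exp _
      have h3 : Real.exp (-lam * x₀) * Real.exp (lam * x₀) = 1 := by
        rw [← Real.exp_add]
        simp
      have h4 := Real.exp_pos (-lam * x₀)
      by_contra! h5
      have h6 : (1 - x₀) * (lam * x₀ + 1) ≤ 1 :=
        (mul_le_mul h5 h2 (by rw [hlx]; linarith) h4.le).trans_eq h3
      have h7 : x₀ * (lam * x₀) = x₀ * ((lam - 1) / 2) := by rw [hlx]
      nlinarith
    have hcont : ContinuousOn (fun x => Real.exp (-lam * x) - (1 - x)) (Set.Icc x₀ 1) := by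
      fun_prop
    have hivt := intermediate_value_Icc hx₀lt.le hcont
    have h0 : (0 : ℝ) ∈ Set.Icc (Real.exp (-lam * x₀) - (1 - x₀))
        (Real.exp (-lam * 1) - (1 - 1)) :=
      ⟨by linarith, by simp [Real.exp_nonneg]⟩
    obtain ⟨x, hx, hx0⟩ := hivt h0
    have hx1 : x ≠ 1 := by
      rintro rfl
      have := Real.exp_pos (-lam * 1)
      simp only [] at hx0
      linarith
    exact ⟨x, ⟨by linarith [hx.1], lt_of_le_of_ne hx.2 hx1⟩, by simp only [] at hx0; linarith⟩
  have huniq : ∀ x ∈ S, ∀ y ∈ S, ¬ x < y := by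
    rintro x ⟨⟨hx0, hx1⟩, hx⟩ y ⟨⟨hy0, hy1⟩, hy⟩ hxy
    have ha : 0 < 1 - x / y := by
      rw [sub_pos, div_lt_one hy0]
      exact hxy
    have hb : 0 < x / y := div_pos hx0 hy0
    have hne : (0 : ℝ) ≠ -lam * y := by nlinarith
    have hconv := strictConvexOn_exp.2 (Set.mem_univ 0) (Set.mem_univ (-lam * y)) hne ha hb
      (by ring)
    simp only [smul_eq_mul, mul_zero, zero_add, Real.exp_zero, mul_one] at hconv
    rw [show x / y * (-lam * y) = -lam * x by field_simp, hx, hy] at hconv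
    have : x / y * (1 - y) = x / y - x := by field_simp
    linarith
  obtain ⟨x, hx⟩ := hex
  have hSx : S = {x} := by
    ext y
    rw [Set.mem_singleton_iff]
    constructor
    · intro hy
      exact le_antisymm (not_lt.1 (huniq x hx y hy)) (not_lt.1 (huniq y hy x hx))
    · rintro rfl
      exact hx
  rw [htheta, hSx, csSup_singleton]
  exact ⟨hx.1.1, hx.1.2, hx.2⟩

theorem mul_one_sub_lt_one {lam θ : ℝ} (hlam : 0 < lam) (hθ : 0 < θ)
    (h : Real.exp (-lam * θ) = 1 - θ) : lam * (1 - θ) < 1 := by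
  have h1 : lam * θ + 1 < Real.exp (lam * θ) := Real.add_one_lt_exp (by positivity)
  have h2 : Real.exp (lam * θ) * (1 - θ) = 1 := by
    rw [← h, ← Real.exp_add]
    simp
  have h3 : 0 < 1 - θ := h ▸ Real.exp_pos _
  have h4 : (lam * θ + 1) * (1 - θ) < 1 := (mul_lt_mul_of_pos_right h1 h3).trans_eq h2
  nlinarith

theorem one_sub_add_le_exp {lam θ : ℝ} (h : Real.exp (-lam * θ) = 1 - θ) (x : ℝ) :
    1 - x + (1 - lam * (1 - θ)) * (x - θ) ≤ Real.exp (-lam * x) := by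
  have h1 : -lam * (x - θ) + 1 ≤ Real.exp (-lam * (x - θ)) := Real.add_one_le_exp _
  have h2 : Real.exp (-lam * x) = (1 - θ) * Real.exp (-lam * (x - θ)) := by
    rw [← h, ← Real.exp_add]
    ring_nf
  have h3 : 0 < 1 - θ := h ▸ Real.exp_pos _
  rw [h2]
  nlinarith

theorem exists_mul_min_le {lam θ : ℝ} (hθ : 0 < θ) (hθ1 : θ < 1)
    (h : Real.exp (-lam * θ) = 1 - θ) :
    ∃ δ : ℝ, 0 < δ ∧ ∀ x, 0 ≤ x → x ≤ θ → δ * min x (θ - x) ≤ 1 - x - Real.exp (-lam * x) := by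
  set e := Real.exp (-lam * (θ / 2)) with he
  have he0 : 0 < e := Real.exp_pos _
  have hesq : e ^ 2 = 1 - θ := by
    rw [he, ← h, sq, ← Real.exp_add]
    ring_nf
  have hη : 0 < 1 - θ / 2 - e := by
    have hlt : e ^ 2 < (1 - θ / 2) ^ 2 := by
      rw [hesq]
      linarith [pow_pos hθ 2]
    linarith [lt_of_pow_lt_pow_left₀ 2 (by linarith) hlt]
  refine ⟨2 / θ * (1 - θ / 2 - e), by positivity, fun x hx hxθ => ?_⟩
  rcases le_total x (θ / 2) with hx2 | hx2
  · have ha : 0 ≤ 1 - 2 / θ * x := by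
      rw [sub_nonneg, div_mul_eq_mul_div, div_le_one hθ]
      linarith
    have hb : 0 ≤ 2 / θ * x := by positivity
    have hconv := convexOn_exp.2 (Set.mem_univ 0) (Set.mem_univ (-lam * (θ / 2))) ha hb (by ring)
    simp only [smul_eq_mul, mul_zero, zero_add, Real.exp_zero, mul_one] at hconv
    rw [show 2 / θ * x * (-lam * (θ / 2)) = -lam * x by field_simp, ← he] at hconv
    have h1 : 2 / θ * (1 - θ / 2 - e) * x = 2 / θ * x * (1 - e) - x := by
      field_simp
      ring
    rw [min_eq_left (by linarith), h1]
    linarith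
  · have ha : 0 ≤ 1 - 2 / θ * (θ - x) := by
      rw [sub_nonneg, div_mul_eq_mul_div, div_le_one hθ]
      linarith
    have hb : 0 ≤ 2 / θ * (θ - x) := mul_nonneg (by positivity) (sub_nonneg.2 hxθ)
    have hconv := convexOn_exp.2 (Set.mem_univ (-lam * θ)) (Set.mem_univ (-lam * (θ / 2))) ha hb
      (by ring)
    simp only [smul_eq_mul] at hconv
    rw [show (1 - 2 / θ * (θ - x)) * (-lam * θ) + 2 / θ * (θ - x) * (-lam * (θ / 2)) = -lam * x by
      field_simp; ring, ← he, h] at hconv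
    have h1 : 2 / θ * (1 - θ / 2 - e) * (θ - x) =
        1 - x - ((1 - 2 / θ * (θ - x)) * (1 - θ) + 2 / θ * (θ - x) * e) := by
      field_simp
      ring
    rw [min_eq_right (by linarith), h1]
    linarith

theorem pow_sub_pow_le {a b : ℝ} (hb : 0 ≤ b) (hab : b ≤ a) (ha : a ≤ 1) (t : ℕ) :
    a ^ t - b ^ t ≤ t * (a - b) := by
  induction t with
  | zero => simp
  | succ t ih =>
    have h1 : b ^ t ≤ 1 := pow_le_one₀ hb (hab.trans ha)
    have h2 : 0 ≤ a ^ t - b ^ t := sub_nonneg.2 (pow_le_pow_left₀ hb hab t)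
    have h3 : a * (a ^ t - b ^ t) ≤ a ^ t - b ^ t := mul_le_of_le_one_left h2 ha
    have h4 : b ^ t * (a - b) ≤ a - b := mul_le_of_le_one_left (by linarith) h1
    push_cast
    rw [pow_succ, pow_succ]
    linarith

theorem one_sub_pow_le_exp {lam : ℝ} {n : ℕ} (hn : lam ≤ n) (hn0 : 0 < n) (t : ℕ) :
    (1 - lam / n) ^ t ≤ Real.exp (-lam * (t / n)) := by
  have hn' : (0 : ℝ) < n := by exact_mod_cast hn0
  have h0 : 0 ≤ 1 - lam / n := by
    rw [sub_nonneg, div_le_one hn']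
    exact hn
  have h1 := pow_le_pow_left₀ h0 (Real.one_sub_le_exp_neg (lam / n)) t
  rw [← Real.exp_nat_mul] at h1
  refine h1.trans_eq (congrArg _ ?_)
  ring

theorem exp_sub_le_one_sub_pow {lam : ℝ} {n : ℕ} (hlam : 0 ≤ lam) (hn : lam ≤ n) (hn0 : 0 < n)
    {t : ℕ} (ht : t ≤ n) :
    n * Real.exp (-lam * (t / n)) - lam ^ 2 ≤ n * (1 - lam / n) ^ t := by
  have hn' : (0 : ℝ) < n := by exact_mod_cast hn0
  have hp0 : 0 ≤ lam / n := by positivity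
  have hp1 : lam / n ≤ 1 := by
    rw [div_le_one hn']
    exact hn
  have h1 := pow_sub_pow_le (sub_nonneg.2 hp1) (Real.one_sub_le_exp_neg (lam / n))
    (Real.exp_le_one_iff.2 (by linarith)) t
  have h2 : Real.exp (-(lam / n)) - (1 - lam / n) ≤ (lam / n) ^ 2 := by
    have := (abs_le.1 (Real.abs_exp_sub_one_sub_id_le (x := -(lam / n))
      (by rw [abs_neg, abs_of_nonneg hp0]; exact hp1))).2
    rw [neg_sq] at this
    linarith
  have h3 : Real.exp (-(lam / n)) ^ t = Real.exp (-lam * (t / n)) := by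
    rw [← Real.exp_nat_mul]
    ring_nf
  have h4 : (t : ℝ) * (Real.exp (-(lam / n)) - (1 - lam / n)) ≤ n * (lam / n) ^ 2 :=
    mul_le_mul (by exact_mod_cast ht) h2 (by linarith [Real.one_sub_le_exp_neg (lam / n)]) hn'.le
  rw [h3] at h1
  have h5 : (n : ℝ) * (n * (lam / n) ^ 2) = lam ^ 2 := by field_simp
  have h6 := mul_le_mul_of_nonneg_left (h1.trans h4) hn'.le
  rw [h5, mul_sub] at h6
  linarith

/-- Deterministic consequences, for the set `Z` of seed times, of the concentration of the number
of undiscovered vertices: a unique long excursion, of the expected length. -/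
theorem exists_long_excursion {lam : ℝ} (hlam : 1 < lam) :
    ∃ K ε : ℝ, 0 < K ∧ 0 < ε ∧ ε ≤ 1 / lam ∧ ∀ (n : ℕ) (b : ℝ) (Z : ℕ → Prop),
      0 < n → lam ≤ n → 1 ≤ b → b ≤ ε * n → Z 0 → Z n →
      (∀ s, s ≤ n → Z s → (n : ℝ) - s ≤ (1 - lam / n) ^ s * n + b) →
      (∀ t, t ≤ n → (1 - lam / n) ^ t * n - b - ((Finset.range t).filter Z).card ≤ (n : ℝ) - t) →
      (∀ s t, t ≤ n → Consecutive Z s t →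
        (1 - lam / n) ^ (t - s) * ((n : ℝ) - s - 1) - 2 * b ≤ (n : ℝ) - t) →
      ∃ s₁ s₂ : ℕ, s₂ ≤ n ∧ Consecutive Z s₁ s₂ ∧ (s₁ : ℝ) ≤ K * b ∧
        (((Finset.range s₂).filter Z).card : ℝ) ≤ K * b ∧
        |(1 - lam / n) ^ s₂ - (1 - theta lam)| * n ≤ K * b ∧
        ∀ s t, t ≤ n → Consecutive Z s t → s ≠ s₁ → t - s < s₂ - s₁ := by
  obtain ⟨hθ, hθ1, hθe⟩ := theta_spec hlam
  set θ := theta lam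
  have hlam0 : 0 < lam := by linarith
  have hμ := sub_pos.2 (mul_one_sub_lt_one hlam0 hθ hθe)
  have htan := one_sub_add_le_exp hθe
  set μ := 1 - lam * (1 - θ) with hμdef
  obtain ⟨δ, hδ, hδg⟩ := exists_mul_min_le hθ hθ1 hθe
  set K₁ := 1 / δ with hK₁
  have hK₁0 : 0 < K₁ := by positivity
  set K₂ := (lam ^ 2 + K₁ + 2) / μ with hK₂
  have hK₂0 : 0 < K₂ := by positivity
  set ε := min (1 / lam) (min (μ / (2 * lam * K₁)) (θ / (2 * (3 * K₁ + 6 / μ)))) with hε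
  have hε1 : ε ≤ 1 / lam := min_le_left _ _
  have hε2 : lam * (K₁ * ε) ≤ μ / 2 := by
    have h : ε ≤ μ / (2 * lam * K₁) := (min_le_right _ _).trans (min_le_left _ _)
    rw [le_div_iff₀ (by positivity)] at h
    linarith
  have hε3 : (3 * K₁ + 6 / μ) * ε < θ := by
    have h : ε ≤ θ / (2 * (3 * K₁ + 6 / μ)) := (min_le_right _ _).trans (min_le_right _ _)
    rw [le_div_iff₀ (by positivity)] at h
    linarith
  have hε0 : 0 < ε := by positivity
  refine ⟨2 * K₁ + K₂ + 3, ε, by positivity, hε0, hε1, ?_⟩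
  intro n b Z hn0 hn hb hbε hZ0 hZn H1 H2 H3
  have hn' : (0 : ℝ) < n := by exact_mod_cast hn0
  have hKb : K₁ * b ≤ K₁ * ε * n := by
    rw [mul_assoc]
    exact mul_le_mul_of_nonneg_left hbε hK₁0.le
  have hgap : (3 * K₁ + 6 / μ) * b < θ * n := by
    calc (3 * K₁ + 6 / μ) * b ≤ (3 * K₁ + 6 / μ) * (ε * n) :=
          mul_le_mul_of_nonneg_left hbε (by positivity)
      _ = (3 * K₁ + 6 / μ) * ε * n := by ring
      _ < θ * n := mul_lt_mul_of_pos_right hε3 hn'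
  have hμb : 0 ≤ 6 / μ * b := by positivity
  have hK₁b : 0 ≤ K₁ * b := by positivity
  have hθn : θ * n < n := by nlinarith
  have dich : ∀ s, s ≤ n → Z s → (s : ℝ) ≤ K₁ * b ∨ θ * n - K₁ * b ≤ s := by
    intro s hs hZs
    by_contra! hcon
    obtain ⟨hc1, hc2⟩ := hcon
    have h1 := H1 s hs hZs
    have h2 := one_sub_pow_le_exp hn hn0 s
    have hxθ : (s : ℝ) / n ≤ θ := by
      rw [div_le_iff₀ hn']
      linarith
    have h3 := hδg (s / n) (by positivity) hxθ
    have h4 : (n : ℝ) * (1 - s / n - Real.exp (-lam * (s / n))) ≤ b := by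
      have := mul_le_mul_of_nonneg_right h2 hn'.le
      have h5 : (n : ℝ) * (s / n) = s := by field_simp
      linarith
    have h6 : K₁ * b < (n : ℝ) * min ((s : ℝ) / n) (θ - s / n) := by
      rw [mul_min_of_nonneg _ _ hn'.le, lt_min_iff]
      have h5 : (n : ℝ) * (s / n) = s := by field_simp
      rw [mul_sub, h5]
      constructor <;> linarith
    have h7 : b < n * (δ * min ((s : ℝ) / n) (θ - s / n)) := by
      have := mul_lt_mul_of_pos_left h6 hδ
      have h8 : δ * (K₁ * b) = b := by
        rw [hK₁]
        field_simp
      linarith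
    have := mul_le_mul_of_nonneg_left h3 hn'.le
    linarith
  set P : ℕ → Prop := fun i => Z i ∧ (i : ℝ) ≤ K₁ * b with hP
  have hP0 : P 0 := ⟨hZ0, by simpa using hK₁b⟩
  set s₁ := Nat.findGreatest P n with hs₁
  obtain ⟨hZs₁, hs₁b⟩ : P s₁ := Nat.findGreatest_spec (Nat.zero_le n) hP0
  have hmax : ∀ i, i ≤ n → Z i → (i : ℝ) ≤ K₁ * b → i ≤ s₁ := fun i hi hZi hib =>
    Nat.le_findGreatest hi ⟨hZi, hib⟩
  have hs₁n : s₁ < n := by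
    have : (s₁ : ℝ) < n := by linarith
    exact_mod_cast this
  obtain ⟨s₂, hs₂n, hcons⟩ := exists_consecutive hZs₁ hZn hs₁n
  obtain ⟨hlt, -, hZs₂, hno⟩ := id hcons
  have hs₂low : θ * n - K₁ * b ≤ s₂ := by
    refine (dich s₂ hs₂n hZs₂).resolve_left fun h => ?_
    exact absurd (hmax s₂ hs₂n hZs₂ h) (by omega)
  have hσ : (((Finset.range s₂).filter Z).card : ℝ) ≤ K₁ * b + 1 := by
    have hsub : (Finset.range s₂).filter Z ⊆ Finset.range (s₁ + 1) := by
      intro i hi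
      rw [Finset.mem_filter, Finset.mem_range] at hi
      rw [Finset.mem_range]
      by_contra hcon
      exact hno i (by omega) hi.1 hi.2
    have := Finset.card_le_card hsub
    rw [Finset.card_range] at this
    have : (((Finset.range s₂).filter Z).card : ℝ) ≤ s₁ + 1 := by exact_mod_cast this
    linarith
  have hs₂up : (s₂ : ℝ) - θ * n ≤ K₂ * b := by
    have h1 := H2 s₂ hs₂n
    have h2 := exp_sub_le_one_sub_pow hlam0.le hn hn0 hs₂n
    have h3 := mul_le_mul_of_nonneg_left (htan (s₂ / n)) hn'.le
    have h4 : (n : ℝ) * (1 - s₂ / n + μ * (s₂ / n - θ)) = n - s₂ + μ * (s₂ - θ * n) := by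
      field_simp
    rw [h4] at h3
    have h5 : μ * (s₂ - θ * n) ≤ (lam ^ 2 + K₁ + 2) * b := by nlinarith [sq_nonneg lam]
    rw [hK₂, div_mul_eq_mul_div, le_div_iff₀ hμ]
    linarith
  have hK₂b : 0 ≤ K₂ * b := by positivity
  refine ⟨s₁, s₂, hs₂n, hcons, ?_, ?_, ?_, ?_⟩
  · linarith
  · linarith
  · rw [← abs_of_pos hn', ← abs_mul, abs_of_pos hn', abs_le]
    have h1 := H1 s₂ hs₂n hZs₂
    have h2 := H2 s₂ hs₂n
    constructor <;> linarith
  · intro s t htn hst hss₁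
    have hbig : θ * n - 2 * (K₁ * b) ≤ ((s₂ - s₁ : ℕ) : ℝ) := by
      rw [Nat.cast_sub hlt.le]
      linarith
    suffices h : ((t - s : ℕ) : ℝ) < ((s₂ - s₁ : ℕ) : ℝ) by exact_mod_cast h
    have hsn : s ≤ n := hst.1.le.trans htn
    rcases dich s hsn hst.2.1 with h | h
    · have hss : s < s₁ := lt_of_le_of_ne (hmax s hsn hst.2.1 h) hss₁
      have hts : t ≤ s₁ := by
        by_contra hcon
        exact hst.2.2.2 s₁ hss (by omega) hZs₁
      have : ((t - s : ℕ) : ℝ) ≤ s₁ := by exact_mod_cast (Nat.sub_le t s).trans hts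
      linarith
    · have h1 := H3 s t htn hst
      have hp1 : lam / n ≤ 1 := by
        rw [div_le_one hn']
        exact hn
      have hbern := one_add_mul_le_pow (a := -(lam / n)) (by linarith) (t - s)
      rw [← sub_eq_add_neg] at hbern
      have hsn1 : (0 : ℝ) ≤ (n : ℝ) - s - 1 := by
        have : (s : ℝ) + 1 ≤ n := by exact_mod_cast hst.1.trans_le htn
        linarith
      have h2 := mul_le_mul_of_nonneg_right hbern hsn1
      set d : ℝ := ((t - s : ℕ) : ℝ) with hd
      have hdt : d = t - s := by rw [hd, Nat.cast_sub hst.1.le]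
      have hd0 : 0 ≤ d := Nat.cast_nonneg _
      have h3 : lam / n * ((n : ℝ) - s - 1) ≤ 1 - μ / 2 := by
        rw [div_mul_eq_mul_div, div_le_iff₀ hn']
        have h4 : lam * ((n : ℝ) - s - 1) ≤ lam * (n - θ * n + K₁ * ε * n) :=
          mul_le_mul_of_nonneg_left (by linarith) hlam0.le
        have h5 := mul_le_mul_of_nonneg_right hε2 hn'.le
        have h6 : (1 - μ / 2) * n = lam * (1 - θ) * n + μ / 2 * n := by rw [hμdef]; ring
        linarith
      have h4 := mul_le_mul_of_nonneg_left h3 hd0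
      have h5 : d * (μ / 2) ≤ 3 * b := by linarith
      have h6 : d ≤ 6 / μ * b := by
        rw [div_mul_eq_mul_div, le_div_iff₀ hμ]
        linarith
      linarith

theorem bernExp_not_concentrated_le {n : ℕ} [NeZero n] {p : ℝ} (hp : 0 ≤ p) (hp1 : p ≤ 1)
    (b : ℝ) (W : Finset (Fin n)) {s : ℝ} (hs : 0 ≤ s) (hs1 : s ≤ 1) :
    bernExp p (allPairs n) (fun E => if Concentrated p b W E then 0 else 1) ≤
      2 * Real.exp (s ^ 2 * (p * n) * n - s * (b * (1 - p) ^ n)) := by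
  have key : ∀ r : ℝ, |r| ≤ 1 → r ^ 2 = s ^ 2 →
      bernExp p (allPairs n) (fun E => if ∃ j, s * (b * (1 - p) ^ n) ≤ 0 + r *
        ∑ i ∈ Finset.range j, exploreInc p W (explored E i) (explored E (i + 1)) then 1 else 0) ≤
      Real.exp (s ^ 2 * (p * n) * n - s * (b * (1 - p) ^ n)) := by
    intro r hr hrs
    have h := bernExp_exploreInc_maximal hp hp1 W hr (s * (b * (1 - p) ^ n)) n
      (Finset.univ, Finset.univ) 0 (Finset.Subset.refl _) (by simp)
    rw [pairsIn_univ] at h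
    refine h.trans_eq ?_
    rw [hrs, ← Real.exp_nat_mul, ← Real.exp_add]
    ring_nf
  have h1 := key s (by rwa [abs_of_nonneg hs]) rfl
  have h2 := key (-s) (by rwa [abs_neg, abs_of_nonneg hs]) (neg_sq s)
  rw [two_mul]
  refine le_trans ?_ (add_le_add h1 h2)
  rw [← bernExp_add]
  refine bernExp_mono hp hp1 fun E _ => ?_
  by_cases hc : Concentrated p b W E
  · rw [if_pos hc]
    split_ifs <;> norm_num
  · rw [if_neg hc]
    simp only [Concentrated, not_forall, not_lt] at hc
    obtain ⟨t, ht⟩ := hc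
    have hst := mul_le_mul_of_nonneg_left ht hs
    rcases abs_choice (∑ i ∈ Finset.range t,
      exploreInc p W (explored E i) (explored E (i + 1))) with habs | habs
    · rw [habs] at hst
      rw [if_pos ⟨t, by rw [zero_add]; exact hst⟩]
      split_ifs <;> norm_num
    · rw [habs] at hst
      rw [add_comm, if_pos ⟨t, by rw [zero_add, neg_mul, ← mul_neg]; exact hst⟩]
      split_ifs <;> norm_num

/-- Every component of maximum size meets `U` in `θ(lam) |U|` vertices, up to an error less
than `A √n`. -/
def GiantClose {n : ℕ} (lam A : ℝ) (U : Finset (Fin n)) (E : Finset (Fin n × Fin n)) : Prop :=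
  ∀ v : Fin n, compCard E v = L1 E →
    |(((Finset.univ.filter (fun u => (graphOf E).Reachable v u)) ∩ U).card : ℝ)
      - theta lam * (U.card : ℝ)| < A * Real.sqrt n

theorem GiantClose.mono {n : ℕ} {lam A A' : ℝ} {U : Finset (Fin n)} {E : Finset (Fin n × Fin n)}
    (h : GiantClose lam A U E) (hA : A ≤ A') : GiantClose lam A' U E := fun v hv =>
  (h v hv).trans_le (mul_le_mul_of_nonneg_right hA (Real.sqrt_nonneg _))

theorem giantClose_of_sqrt_lt {n : ℕ} {lam A : ℝ} (hlam : 1 < lam) (hA : Real.sqrt n < A)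
    (U : Finset (Fin n)) (E : Finset (Fin n × Fin n)) : GiantClose lam A U E := by
  intro v _
  obtain ⟨hθ, hθ1, -⟩ := theta_spec hlam
  have hn : (0 : ℝ) < n := by exact_mod_cast v.pos
  have hU : (U.card : ℝ) ≤ n := by
    exact_mod_cast (Finset.card_le_univ U).trans_eq (Fintype.card_fin n)
  set C := Finset.univ.filter (fun u => (graphOf E).Reachable v u)
  have hC : ((C ∩ U).card : ℝ) ≤ n := by
    exact_mod_cast (Finset.card_le_univ (C ∩ U)).trans_eq (Fintype.card_fin n)
  have h0 : (0 : ℝ) ≤ (C ∩ U).card := Nat.cast_nonneg _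
  have h1 : 0 ≤ theta lam * (U.card : ℝ) := by positivity
  have h2 : theta lam * (U.card : ℝ) ≤ n :=
    (mul_le_of_le_one_left (Nat.cast_nonneg _) hθ1.le).trans hU
  have h3 : (n : ℝ) < A * Real.sqrt n := by
    calc (n : ℝ) = Real.sqrt n * Real.sqrt n := (Real.mul_self_sqrt hn.le).symm
      _ < A * Real.sqrt n := mul_lt_mul_of_pos_right hA (Real.sqrt_pos.2 hn)
  refine lt_of_le_of_lt ?_ h3
  rw [abs_le]
  constructor <;> linarith

theorem exists_abs_card_inter_sub_le {lam : ℝ} (hlam : 1 < lam) :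
    ∃ K ε : ℝ, 0 < K ∧ 0 < ε ∧ ε ≤ 1 / lam ∧ ∀ (n : ℕ) [NeZero n] (b : ℝ)
      (U : Finset (Fin n)) (E : Finset (Fin n × Fin n)), lam < n → 1 ≤ b → b ≤ ε * n →
      E ⊆ allPairs n → Concentrated (lam / n) b Finset.univ E → Concentrated (lam / n) b U E →
      ∀ v : Fin n, compCard E v = L1 E →
        |(((Finset.univ.filter (fun u => (graphOf E).Reachable v u)) ∩ U).card : ℝ)
          - theta lam * (U.card : ℝ)| ≤ K * b := by
  obtain ⟨K, ε, hK, hε, hεlam, hnum⟩ := exists_long_excursion hlam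
  refine ⟨3 * K + 1, ε, by positivity, hε, hεlam, ?_⟩
  intro n _ b U E hn hb hbε hE hV hU v hv
  have hn0 : 0 < n := NeZero.pos n
  have hn' : (0 : ℝ) < n := by exact_mod_cast hn0
  have hp0 : 0 ≤ lam / n := div_nonneg (by linarith) hn'.le
  have hp1 : lam / n < 1 := by
    rw [div_lt_one hn']
    exact hn
  have hb0 : 0 ≤ b := by linarith
  obtain ⟨s₁, s₂, hs₂n, hcons, hs₁, hσ, hpow, huniq⟩ := hnum n b (IsSeedTime E) hn0 hn.le hb hbε
    (isSeedTime_zero E) (isSeedTime_self E)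
    (by
      intro s hs hZ
      have h := hV.card_le hp1 hb0 hp0 hs
      rwa [Finset.inter_univ, ← hZ, card_explored, Nat.cast_sub hs, Finset.card_univ,
        Fintype.card_fin] at h)
    (by
      intro t ht
      have h := hV.le_card hp1 hb0 hp0 ht
      rw [Finset.inter_univ, Finset.card_univ, Fintype.card_fin] at h
      have h2 : ((explored E t).2.card : ℝ) ≤ (n : ℝ) - t := by
        rw [← Nat.cast_sub ht, ← card_explored E t]
        exact_mod_cast Finset.card_le_card (explored_subset E t)
      exact h.trans h2)
    (fun s t ht hst => hV.le_of_consecutive hp1 hb0 hp0 hst ht)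
  obtain ⟨s, t, htn, hst, hvs, hvt⟩ := exists_consecutive_mem E v
  have hC := filter_reachable_eq hE hst hvs hvt
  have hcard : t - s = L1 E := by
    rw [← hv, compCard, hC, card_explored_sdiff E hst.1.le htn]
  have hss : s = s₁ := by
    by_contra hne
    have h1 := huniq s t htn hst hne
    have h2 := sub_le_L1 hE hcons hs₂n
    omega
  subst hss
  obtain rfl := hst.right_unique hcons
  have hinter : ((explored E s).1 \ (explored E t).1) ∩ U =
      ((explored E s).1 ∩ U) \ ((explored E t).1 ∩ U) := by
    ext w
    simp only [Finset.mem_inter, Finset.mem_sdiff]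
    tauto
  have hsub : (explored E t).1 ∩ U ⊆ (explored E s).1 ∩ U :=
    Finset.inter_subset_inter_right (explored_antitone E hst.1.le)
  have hlow : (U.card : ℝ) - s ≤ ((explored E s).1 ∩ U).card := by
    have h1 : U.card - ((explored E s).1 ∩ U).card ≤ s := by
      have h2 : U \ (explored E s).1 ⊆ Finset.univ \ (explored E s).1 :=
        Finset.sdiff_subset_sdiff (Finset.subset_univ _) (Finset.Subset.refl _)
      have h3 := Finset.card_le_card h2
      rw [Finset.card_sdiff, Finset.card_univ_sdiff, card_explored, Fintype.card_fin] at h3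
      omega
    have h4 : U.card ≤ s + ((explored E s).1 ∩ U).card := by omega
    have h5 : (U.card : ℝ) ≤ s + ((explored E s).1 ∩ U).card := by exact_mod_cast h4
    linarith
  have hup : (((explored E s).1 ∩ U).card : ℝ) ≤ U.card := by
    exact_mod_cast Finset.card_le_card Finset.inter_subset_right
  have h1 := hU.card_le hp1 hb0 hp0 htn
  have h2 := hU.le_card hp1 hb0 hp0 htn
  rw [← hst.2.2.1] at h1 h2
  have hUn : (U.card : ℝ) ≤ n := by
    exact_mod_cast (Finset.card_le_univ U).trans_eq (Fintype.card_fin n)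
  have h3 : |(1 - lam / n) ^ t * U.card - (1 - theta lam) * U.card| ≤ K * b := by
    rw [← sub_mul, abs_mul, Nat.abs_cast]
    exact (mul_le_mul_of_nonneg_left hUn (abs_nonneg _)).trans hpow
  rw [abs_le] at h3
  rw [hC, hinter, Finset.card_sdiff_of_subset hsub, Nat.cast_sub (Finset.card_le_card hsub), abs_le]
  have hKb : 0 ≤ K * b := by positivity
  constructor <;> linarith [h3.1, h3.2]

theorem exists_bernExp_giantClose_ge {lam : ℝ} (hlam : 1 < lam) :
    ∃ (c K ε : ℝ) (N : ℕ), 0 < c ∧ 0 < K ∧ 0 < ε ∧ ∀ n : ℕ, N ≤ n → lam < n ∧ 1 ≤ ε * n ∧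
      ∀ (A : ℝ) (U : Finset (Fin n)), K ≤ A * Real.sqrt n → A * Real.sqrt n ≤ K * (ε * n) →
        1 - 4 * Real.exp (-c * A ^ 2) ≤
          bernExp (lam / n) (allPairs n) (fun E => if GiantClose lam A U E then 1 else 0) := by
  obtain ⟨K, ε, hK, hε, hεlam, hdet⟩ := exists_abs_card_inter_sub_le hlam
  have hlam0 : 0 < lam := by linarith
  set c₀ := Real.exp (-lam) / 2 with hc₀
  have hc₀pos : 0 < c₀ := by positivity
  have hc₀1 : c₀ ≤ 1 := by
    have : Real.exp (-lam) ≤ 1 := Real.exp_le_one_iff.2 (by linarith)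
    linarith
  obtain ⟨N, hN⟩ := exists_nat_gt (max lam (max (1 / ε) (lam ^ 2 / c₀)))
  refine ⟨c₀ ^ 2 / (4 * lam * (K + 1) ^ 2), K + 1, ε, N, by positivity, by positivity, hε, ?_⟩
  intro n hn
  have hNn : max lam (max (1 / ε) (lam ^ 2 / c₀)) < n := hN.trans_le (by exact_mod_cast hn)
  obtain ⟨hn1, hn2⟩ := max_lt_iff.1 hNn
  obtain ⟨hn2, hn3⟩ := max_lt_iff.1 hn2
  have hn' : (0 : ℝ) < n := hlam0.trans hn1
  have hn0 : 0 < n := by exact_mod_cast hn'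
  have : NeZero n := ⟨hn0.ne'⟩
  refine ⟨hn1, by rw [div_lt_iff₀ hε] at hn2; linarith, ?_⟩
  intro A U hA1 hA2
  have hp0 : 0 ≤ lam / n := by positivity
  have hp1 : lam / n ≤ 1 := by
    rw [div_le_one hn']
    exact hn1.le
  set b := A * Real.sqrt n / (K + 1) with hb
  have hAb : A * Real.sqrt n = (K + 1) * b := by
    rw [hb]
    field_simp
  have hb1 : 1 ≤ b := by
    rw [hb, le_div_iff₀ (by positivity)]
    linarith
  have hbε : b ≤ ε * n := by
    rw [hb, div_le_iff₀ (by positivity)]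
    linarith
  have hqn : c₀ ≤ (1 - lam / n) ^ n := by
    have h := exp_sub_le_one_sub_pow hlam0.le hn1.le hn0 le_rfl
    rw [div_self hn'.ne', mul_one] at h
    rw [div_lt_iff₀ hc₀pos] at hn3
    refine le_of_mul_le_mul_left ?_ hn'
    have : (n : ℝ) * Real.exp (-lam) = n * c₀ + n * c₀ := by
      rw [hc₀]
      ring
    linarith
  set s := b * c₀ / (2 * lam * n) with hs
  have hs0 : 0 ≤ s := by positivity
  have hs1 : s ≤ 1 := by
    rw [hs, div_le_one (by positivity)]
    have hε1 : ε ≤ 1 := hεlam.trans (by rw [div_le_one hlam0]; exact hlam.le)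
    have h1 : b * c₀ ≤ n * 1 := mul_le_mul
      (hbε.trans (mul_le_of_le_one_left hn'.le hε1)) hc₀1 hc₀pos.le hn'.le
    nlinarith
  have hexp : s ^ 2 * (lam / n * n) * n - s * (b * (1 - lam / n) ^ n) ≤
      -(c₀ ^ 2 / (4 * lam * (K + 1) ^ 2)) * A ^ 2 := by
    have h1 : s * (b * c₀) ≤ s * (b * (1 - lam / n) ^ n) := by gcongr
    have h2 : s ^ 2 * (lam / n * n) * n - s * (b * c₀) = -(b ^ 2 * c₀ ^ 2 / (4 * lam * n)) := by
      rw [hs]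
      field_simp
      ring
    have h3 : b ^ 2 * c₀ ^ 2 / (4 * lam * n) = c₀ ^ 2 / (4 * lam * (K + 1) ^ 2) * A ^ 2 := by
      rw [hb, div_pow, mul_pow, Real.sq_sqrt hn'.le]
      field_simp
    linarith
  have hdev : ∀ W : Finset (Fin n), bernExp (lam / n) (allPairs n)
      (fun E => if Concentrated (lam / n) b W E then 0 else 1) ≤
      2 * Real.exp (-(c₀ ^ 2 / (4 * lam * (K + 1) ^ 2)) * A ^ 2) := fun W =>
    (bernExp_not_concentrated_le hp0 hp1 b W hs0 hs1).trans
      (mul_le_mul_of_nonneg_left (Real.exp_le_exp.2 hexp) zero_le_two)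
  have hmain : (1 : ℝ) ≤ bernExp (lam / n) (allPairs n)
      (fun E => if GiantClose lam A U E then 1 else 0) +
      (bernExp (lam / n) (allPairs n)
        (fun E => if Concentrated (lam / n) b Finset.univ E then 0 else 1) +
      bernExp (lam / n) (allPairs n)
        (fun E => if Concentrated (lam / n) b U E then 0 else 1)) := by
    rw [← bernExp_add, ← bernExp_add]
    refine (bernExp_const (lam / n) (allPairs n) 1).symm.le.trans
      (bernExp_mono hp0 hp1 fun E hE => ?_)
    by_cases h1 : Concentrated (lam / n) b Finset.univ E
    · by_cases h2 : Concentrated (lam / n) b U E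
      · have hG : GiantClose lam A U E := fun v hv => by
          refine (hdet n b U E hn1 hb1 hbε hE h1 h2 v hv).trans_lt ?_
          rw [hAb]
          linarith
        rw [if_pos hG, if_pos h1, if_pos h2]
        norm_num
      · rw [if_neg h2]
        split_ifs <;> norm_num
    · rw [if_neg h1]
      split_ifs <;> norm_num
  have := hdev Finset.univ
  have := hdev U
  linarith

theorem exists_one_sub_le_bernExp_giantClose {lam : ℝ} (hlam : 1 < lam) :
    ∃ c C : ℝ, 0 < c ∧ 0 < C ∧ ∀ A : ℝ, 0 < A → ∀ n : ℕ, ∀ U : Finset (Fin n),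
      1 - C * Real.exp (-c * A ^ 2) ≤
        bernExp (lam / n) (allPairs n) (fun E => if GiantClose lam A U E then 1 else 0) := by
  obtain ⟨c₁, K, ε, N, hc₁, hK, hε, hlarge⟩ := exists_bernExp_giantClose_ge hlam
  set c := min c₁ (c₁ * (K * ε) ^ 2) with hc
  have hc0 : 0 < c := by positivity
  set B := ∑ n ∈ Finset.range N, ∑ E ∈ (allPairs n).powerset,
    |(lam / n) ^ E.card * (1 - lam / n) ^ ((allPairs n).card - E.card)| with hB
  have hB0 : 0 ≤ B := Finset.sum_nonneg fun _ _ => Finset.sum_nonneg fun _ _ => abs_nonneg _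
  set C := 4 + Real.exp (c * K ^ 2) + (1 + B) * Real.exp (c * N) with hC
  have hC0 : 0 < C := by positivity
  have hC1 : 4 ≤ C := by
    have h1 := Real.exp_pos (c * K ^ 2)
    have h2 : 0 ≤ (1 + B) * Real.exp (c * N) := by positivity
    linarith
  have hC2 : Real.exp (c * K ^ 2) ≤ C := by
    have h2 : 0 ≤ (1 + B) * Real.exp (c * N) := by positivity
    linarith
  have hC3 : (1 + B) * Real.exp (c * N) ≤ C := by
    have h1 := Real.exp_pos (c * K ^ 2)
    linarith
  refine ⟨c, C, hc0, hC0, ?_⟩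
  intro A hA n U
  have hCpos : 0 ≤ C * Real.exp (-c * A ^ 2) := by positivity
  rcases lt_or_ge (Real.sqrt n) A with hAn | hAn
  · have : bernExp (lam / n) (allPairs n) (fun E => if GiantClose lam A U E then 1 else 0) = 1 :=
      (bernExp_congr _ fun E _ => if_pos (giantClose_of_sqrt_lt hlam hAn U E)).trans
        (bernExp_const (lam / n) (allPairs n) 1)
    rw [this]
    linarith
  have hAsq : A ^ 2 ≤ n := by
    rw [← Real.sq_sqrt (Nat.cast_nonneg n)]
    exact pow_le_pow_left₀ hA.le hAn 2
  have hmul : ∀ x D : ℝ, A ^ 2 ≤ x → D * Real.exp (c * x) ≤ C → 0 ≤ D →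
      D ≤ C * Real.exp (-c * A ^ 2) := by
    intro x D hx hD hD0
    calc D ≤ D * Real.exp (c * x - c * A ^ 2) := by
          refine le_mul_of_one_le_right hD0 (Real.one_le_exp ?_)
          rw [← mul_sub]
          exact mul_nonneg hc0.le (sub_nonneg.2 hx)
      _ = D * Real.exp (c * x) * Real.exp (-c * A ^ 2) := by
          rw [mul_assoc, ← Real.exp_add]
          ring_nf
      _ ≤ _ := mul_le_mul_of_nonneg_right hD (Real.exp_pos _).le
  rcases lt_or_ge n N with hnN | hnN
  · have h1 : 1 + B ≤ C * Real.exp (-c * A ^ 2) :=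
      hmul N (1 + B) (hAsq.trans (by exact_mod_cast hnN.le)) hC3 (by positivity)
    have h2 : -B ≤ bernExp (lam / n) (allPairs n)
        (fun E => if GiantClose lam A U E then 1 else 0) := by
      have h3 : ∑ E ∈ (allPairs n).powerset,
          |(lam / n) ^ E.card * (1 - lam / n) ^ ((allPairs n).card - E.card)| ≤ B :=
        Finset.single_le_sum (f := fun n : ℕ => ∑ E ∈ (allPairs n).powerset,
          |(lam / n) ^ E.card * (1 - lam / n) ^ ((allPairs n).card - E.card)|)
          (fun _ _ => Finset.sum_nonneg fun _ _ => abs_nonneg _) (Finset.mem_range.2 hnN)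
      refine (neg_le_neg h3).trans ?_
      rw [← Finset.sum_neg_distrib]
      refine Finset.sum_le_sum fun E _ => ?_
      beta_reduce
      split_ifs
      · rw [mul_one]
        exact neg_abs_le _
      · rw [mul_zero]
        exact neg_nonpos.2 (abs_nonneg _)
    linarith
  obtain ⟨hn1, hn2, hprob⟩ := hlarge n hnN
  have hn' : (0 : ℝ) < n := by linarith
  have hp0 : 0 ≤ lam / n := div_nonneg (by linarith) hn'.le
  have hp1 : lam / n ≤ 1 := by
    rw [div_le_one hn']
    exact hn1.le
  have hsqrt : 1 ≤ Real.sqrt n := by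
    rw [Real.one_le_sqrt]
    linarith
  rcases lt_or_ge (A * Real.sqrt n) K with hAK | hAK
  · have hAK' : A ≤ K := (le_mul_of_one_le_right hA.le hsqrt).trans hAK.le
    have h1 : 1 ≤ C * Real.exp (-c * A ^ 2) :=
      hmul (K ^ 2) 1 (pow_le_pow_left₀ hA.le hAK' 2) (by rwa [one_mul]) zero_le_one
    have h2 : 0 ≤ bernExp (lam / n) (allPairs n)
        (fun E => if GiantClose lam A U E then 1 else 0) :=
      (bernExp_const (lam / n) (allPairs n) 0).ge.trans
        (bernExp_mono hp0 hp1 fun E _ => by split_ifs <;> norm_num)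
    linarith
  rcases le_or_gt (A * Real.sqrt n) (K * (ε * n)) with hAε | hAε
  · refine le_trans ?_ (hprob A U hAK hAε)
    have h1 : Real.exp (-c₁ * A ^ 2) ≤ Real.exp (-c * A ^ 2) := by
      rw [Real.exp_le_exp, neg_mul, neg_mul, neg_le_neg_iff]
      exact mul_le_mul_of_nonneg_right (min_le_left _ _) (sq_nonneg A)
    have h2 : 4 * Real.exp (-c₁ * A ^ 2) ≤ C * Real.exp (-c * A ^ 2) :=
      mul_le_mul hC1 h1 (Real.exp_pos _).le hC0.le
    linarith
  · set A' := K * ε * Real.sqrt n with hA'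
    have hA'n : A' * Real.sqrt n = K * (ε * n) := by
      rw [hA', mul_assoc, Real.mul_self_sqrt hn'.le, mul_assoc]
    have hA'A : A' ≤ A := by
      rw [← hA'n] at hAε
      exact (lt_of_mul_lt_mul_right hAε (Real.sqrt_nonneg _)).le
    have h0 := hprob A' U (by rw [hA'n]; exact le_mul_of_one_le_right hK.le hn2) hA'n.le
    have h1 : Real.exp (-c₁ * A' ^ 2) ≤ Real.exp (-c * A ^ 2) := by
      rw [Real.exp_le_exp, neg_mul, neg_mul, neg_le_neg_iff, hA', mul_pow,
        Real.sq_sqrt hn'.le, ← mul_assoc]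
      exact mul_le_mul (min_le_right _ _) hAsq (sq_nonneg A) (by positivity)
    have h2 : 4 * Real.exp (-c₁ * A' ^ 2) ≤ C * Real.exp (-c * A ^ 2) :=
      mul_le_mul hC1 h1 (Real.exp_pos _).le hC0.le
    have h3 : bernExp (lam / n) (allPairs n)
        (fun E => if GiantClose lam A' U E then 1 else 0) ≤
        bernExp (lam / n) (allPairs n) (fun E => if GiantClose lam A U E then 1 else 0) := by
      refine bernExp_mono hp0 hp1 fun E _ => ?_
      by_cases hG : GiantClose lam A' U E
      · rw [if_pos hG, if_pos (hG.mono hA'A)]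
      · rw [if_neg hG]
        split_ifs <;> norm_num
    linarith

/-- Lemma 2.3: for `G(n, λ/n)` with `λ > 1` and any `U ⊆ V`, with
probability at least `1 - C e^{-c A²}`, every maximum-size component `𝓛` satisfies
`||𝓛 ∩ U| - θ(λ)|U|| < A √n`. -/
theorem er_giant_in_subset (lam : ℝ) (hlam : 1 < lam) :
    ∃ c C : ℝ, 0 < c ∧ 0 < C ∧ ∀ A : ℝ, 0 < A → ∀ n : ℕ, ∀ U : Finset (Fin n),
      1 - C * Real.exp (-c * A ^ 2) ≤
        ∑ E ∈ (allPairs n).powerset,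
          (if ∀ v : Fin n, compCard E v = L1 E →
              |(((Finset.univ.filter (fun u => (graphOf E).Reachable v u)) ∩ U).card : ℝ)
                - theta lam * (U.card : ℝ)| < A * Real.sqrt n
            then erProb n (lam / n) E else 0) := by
  obtain ⟨c, C, hc, hC, h⟩ := exists_one_sub_le_bernExp_giantClose hlam
  refine ⟨c, C, hc, hC, fun A hA n U => (h A hA n U).trans_eq (Finset.sum_congr rfl fun E _ => ?_)⟩
  by_cases hG : GiantClose lam A U E
  · beta_reduce
    rw [if_pos hG, mul_one]
    exact (if_pos hG).symm
  · beta_reduce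
    rw [if_neg hG, mul_zero]
    exact (if_neg hG).symm
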